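/- arXiv:2311.08017 — 3 statements merged into one kernel-verified Lean document; each statement's English description precedes it below -/
import Mathlib

section
/- Let p > 1, let n ≥ 1, and let Ω ⊊ ℝⁿ be a nonempty open convex set. Then for every u ∈ C_c^∞(Ω), ∫_Ω ‖∇u(x)‖^p dx ≥ ((p-1)/p)^p ∫_Ω |u(x)|^p / d(x)^p dx, where d(x) = dist(x, Ωᶜ). -/
open MeasureTheory Real

theorem lintegral_Ioc_zero_one_rpow {r : ℝ} (hr : -1 < r) :
    ∫⁻ t in Set.Ioc (0 : ℝ) 1, ENNReal.ofReal (t ^ r) = ENNReal.ofReal (1 / (r + 1)) := by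
  have hi : IntegrableOn (fun t : ℝ => t ^ r) (Set.Ioc 0 1) :=
    (intervalIntegral.intervalIntegrable_rpow' hr).1
  rw [← ofReal_integral_eq_lintegral_ofReal hi, ← intervalIntegral.integral_of_le zero_le_one,
    integral_rpow (Or.inl hr), one_rpow, zero_rpow (by linarith), sub_zero]
  filter_upwards [self_mem_ae_restrict measurableSet_Ioc] with t ht
  exact rpow_nonneg ht.1.le _

theorem rpow_lintegral_Ioc_zero_one_le {p q : ℝ} (hpq : p.HolderConjugate q)
    {G : ℝ → ENNReal} (hG : Measurable G) :
    (∫⁻ t in Set.Ioc (0 : ℝ) 1, G t) ^ p ≤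
      ENNReal.ofReal q ^ (p - 1) *
        ∫⁻ t in Set.Ioc (0 : ℝ) 1, ENNReal.ofReal (t ^ (1 / q)) * G t ^ p := by
  have hp := hpq.pos
  have hq := hpq.symm.pos
  have hpi : 1 / p = 1 - 1 / q := by
    linarith [hpq.inv_add_inv_eq_one, one_div p, one_div q]
  have hpq1 : p / q = p - 1 := hpq.div_conj_eq_sub_one
  have hint : ∫⁻ t in Set.Ioc (0 : ℝ) 1, ENNReal.ofReal (t ^ (-(1 / p))) = ENNReal.ofReal q := by
    rw [lintegral_Ioc_zero_one_rpow]
    · congr 1; rw [hpi]; field_simp; ring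
    · have : 1 / p < 1 := (div_lt_one hp).2 hpq.lt
      linarith
  let f : ℝ → ENNReal := fun t => ENNReal.ofReal (t ^ (1 / (p * q))) * G t
  let g : ℝ → ENNReal := fun t => ENNReal.ofReal (t ^ (-(1 / (p * q))))
  have holder := ENNReal.lintegral_mul_le_Lp_mul_Lq (volume.restrict (Set.Ioc (0 : ℝ) 1)) hpq
    (f := f) (g := g) (by fun_prop) (by fun_prop)
  have h1 : ∫⁻ t in Set.Ioc (0 : ℝ) 1, (f * g) t = ∫⁻ t in Set.Ioc (0 : ℝ) 1, G t := by
    refine setLIntegral_congr_fun measurableSet_Ioc fun t ht => ?_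
    simp only [f, g, Pi.mul_apply]
    rw [mul_right_comm, ← ENNReal.ofReal_mul (rpow_nonneg ht.1.le _), ← rpow_add ht.1]
    simp
  have h2 : ∫⁻ t in Set.Ioc (0 : ℝ) 1, f t ^ p =
      ∫⁻ t in Set.Ioc (0 : ℝ) 1, ENNReal.ofReal (t ^ (1 / q)) * G t ^ p := by
    refine setLIntegral_congr_fun measurableSet_Ioc fun t ht => ?_
    simp only [f]
    rw [ENNReal.mul_rpow_of_nonneg _ _ hp.le,
      ENNReal.ofReal_rpow_of_nonneg (rpow_nonneg ht.1.le _) hp.le, ← rpow_mul ht.1.le]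
    have : 1 / (p * q) * p = 1 / q := by field_simp
    rw [this]
  have h3 : ∫⁻ t in Set.Ioc (0 : ℝ) 1, g t ^ q = ENNReal.ofReal q := by
    rw [← hint]
    refine setLIntegral_congr_fun measurableSet_Ioc fun t ht => ?_
    simp only [g]
    rw [ENNReal.ofReal_rpow_of_nonneg (rpow_nonneg ht.1.le _) hq.le, ← rpow_mul ht.1.le]
    congr 2; field_simp
  rw [h1, h2, h3] at holder
  calc _ ≤ _ := ENNReal.rpow_le_rpow holder hp.le
    _ = _ := by
      rw [ENNReal.mul_rpow_of_nonneg _ _ hp.le, ← ENNReal.rpow_mul, ← ENNReal.rpow_mul, mul_comm,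
        one_div_mul_cancel hp.ne', ENNReal.rpow_one, one_div_mul_eq_div, hpq1]

section Halfspace

variable {E : Type*} [NormedAddCommGroup E] [InnerProductSpace ℝ E]

/-- The affine map contracting towards the hyperplane `⟪a, x⟫ + b = 0` by the factor `t`
along the normal direction `a`. -/
noncomputable def hyperplaneContraction (a : E) (b t : ℝ) (x : E) : E :=
  x - ((1 - t) * (inner ℝ a x + b)) • a

theorem inner_hyperplaneContraction {a : E} (ha : ‖a‖ = 1) (b t : ℝ) (x : E) :
    inner ℝ a (hyperplaneContraction a b t x) + b = t * (inner ℝ a x + b) := by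
  rw [hyperplaneContraction, inner_sub_right, real_inner_smul_right, real_inner_self_eq_norm_sq, ha]
  ring

theorem enorm_div_le_lintegral_hyperplaneContraction {a : E} (ha : ‖a‖ = 1) {b : ℝ} {u : E → ℝ}
    (hu : ContDiff ℝ 1 u) (hu0 : ∀ x, inner ℝ a x + b = 0 → u x = 0) {x : E}
    (hx : 0 < inner ℝ a x + b) :
    ENNReal.ofReal (|u x| / (inner ℝ a x + b)) ≤
      ∫⁻ t in Set.Ioc (0 : ℝ) 1, ‖fderiv ℝ u (hyperplaneContraction a b t x)‖ₑ := by
  set l := inner ℝ a x + b with hl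
  let φ : ℝ → ℝ := fun t => u (hyperplaneContraction a b t x)
  have hφ : ContDiff ℝ 1 φ := by
    unfold φ hyperplaneContraction
    fun_prop
  have hT (t : ℝ) : HasDerivAt (fun t => hyperplaneContraction a b t x) (l • a) t := by
    unfold hyperplaneContraction
    have h1 : HasDerivAt (fun t : ℝ => (1 - t) * l) (-l) t := by
      simpa using ((hasDerivAt_id t).const_sub 1).mul_const l
    simpa using (h1.smul_const a).const_sub x
  have hd (t : ℝ) : ‖deriv φ t‖ₑ ≤
      ENNReal.ofReal l * ‖fderiv ℝ u (hyperplaneContraction a b t x)‖ₑ := by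
    have h := ((hu.differentiable one_ne_zero _).hasFDerivAt.comp_hasDerivAt t (hT t)).deriv
    change deriv φ t = _ at h
    rw [h, map_smul, smul_eq_mul, enorm_mul, Real.enorm_of_nonneg hx.le]
    gcongr
    have := (fderiv ℝ u (hyperplaneContraction a b t x)).le_opENorm a
    rwa [← ofReal_norm a, ha, ENNReal.ofReal_one, mul_one] at this
  have key := enorm_sub_le_lintegral_deriv_of_contDiffOn_Icc hφ.contDiffOn (zero_le_one (α := ℝ))
  have h0 : φ 0 = 0 := hu0 _ (by rw [inner_hyperplaneContraction ha]; simp)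
  have h1 : φ 1 = u x := by simp [φ, hyperplaneContraction]
  rw [h0, h1, sub_zero, ← restrict_Ioc_eq_restrict_Icc] at key
  rw [ENNReal.ofReal_div_of_pos hx, ← Real.norm_eq_abs, ofReal_norm]
  refine ENNReal.div_le_of_le_mul' (key.trans ?_)
  rw [← lintegral_const_mul' _ _ ENNReal.ofReal_ne_top]
  exact lintegral_mono hd

variable [FiniteDimensional ℝ E] [MeasurableSpace E] [BorelSpace E] (μ : Measure E)
  [μ.IsAddHaarMeasure]

theorem lintegral_comp_hyperplaneContraction {a : E} (ha : ‖a‖ = 1) (b : ℝ) {t : ℝ} (ht : 0 < t)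
    {F : E → ENNReal} (hF : Measurable F) :
    ∫⁻ x, F (hyperplaneContraction a b t x) ∂μ = ENNReal.ofReal t⁻¹ * ∫⁻ x, F x ∂μ := by
  let L : E →ₗ[ℝ] E := LinearMap.transvection (innerₗ E a) (-(1 - t) • a)
  have hdet : LinearMap.det L = t := by
    simp only [L, LinearMap.transvection.det]
    simp [ha]
  have hL : Measurable L := (LinearMap.continuous_of_finiteDimensional L).measurable
  have hT (x : E) : hyperplaneContraction a b t x = L x + (-((1 - t) * b)) • a := by
    simp only [hyperplaneContraction, L, LinearMap.transvection.apply, innerₗ_apply_apply]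
    module
  have hF' : Measurable fun y => F (y + (-((1 - t) * b)) • a) := by fun_prop
  simp_rw [hT]
  rw [← lintegral_map hF' hL,
    Measure.map_linearMap_addHaar_eq_smul_addHaar μ (by rw [hdet]; exact ht.ne'), hdet,
    lintegral_smul_measure, abs_of_pos (inv_pos.2 ht), lintegral_add_right_eq_self F, smul_eq_mul]

theorem setLIntegral_comp_hyperplaneContraction_le {a : E} (ha : ‖a‖ = 1) {b t : ℝ} (ht : 0 < t)
    {A : Set E} (hA : MeasurableSet A) (hAT : ∀ x ∈ A, hyperplaneContraction a b t x ∈ A)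
    {F : E → ENNReal} (hF : Measurable F) :
    ∫⁻ x in A, F (hyperplaneContraction a b t x) ∂μ ≤ ENNReal.ofReal t⁻¹ * ∫⁻ x in A, F x ∂μ := by
  rw [← lintegral_indicator hA, ← lintegral_indicator hA,
    ← lintegral_comp_hyperplaneContraction μ ha b ht (hF.indicator hA)]
  refine lintegral_mono (Set.indicator_le (g := fun x => A.indicator F
    (hyperplaneContraction a b t x)) fun x hx => ?_)
  rw [Set.indicator_of_mem (hAT x hx)]

/-- Hardy's inequality, with the distance to a hyperplane, on a set that is starlike in the normal
direction with respect to that hyperplane. -/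
theorem lintegral_hardy_of_hyperplaneContraction_mem {p q : ℝ} (hpq : p.HolderConjugate q)
    {a : E} (ha : ‖a‖ = 1) {b : ℝ} {A : Set E} (hA : MeasurableSet A)
    (hpos : ∀ x ∈ A, 0 < inner ℝ a x + b)
    (hAT : ∀ t ∈ Set.Ioc (0 : ℝ) 1, ∀ x ∈ A, hyperplaneContraction a b t x ∈ A)
    {u : E → ℝ} (hu : ContDiff ℝ 1 u) (hu0 : ∀ x, inner ℝ a x + b = 0 → u x = 0) :
    ∫⁻ x in A, ENNReal.ofReal ((|u x| / (inner ℝ a x + b)) ^ p) ∂μ ≤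
      ENNReal.ofReal q ^ p * ∫⁻ x in A, ‖fderiv ℝ u x‖ₑ ^ p ∂μ := by
  have hp := hpq.pos
  have hq := hpq.symm.pos
  have hpi : 1 / p = 1 - 1 / q := by
    linarith [hpq.inv_add_inv_eq_one, one_div p, one_div q]
  have hcont : Continuous (fderiv ℝ u) := hu.continuous_fderiv one_ne_zero
  have hTc : Continuous fun z : E × ℝ => hyperplaneContraction a b z.2 z.1 := by
    unfold hyperplaneContraction; fun_prop
  have hGm : Measurable fun z : E × ℝ => ‖fderiv ℝ u (hyperplaneContraction a b z.2 z.1)‖ₑ :=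
    (hcont.comp hTc).enorm.measurable
  set I := ∫⁻ x in A, ‖fderiv ℝ u x‖ₑ ^ p ∂μ
  calc ∫⁻ x in A, ENNReal.ofReal ((|u x| / (inner ℝ a x + b)) ^ p) ∂μ
      ≤ ∫⁻ x in A, ENNReal.ofReal q ^ (p - 1) * (∫⁻ t in Set.Ioc (0 : ℝ) 1,
          ENNReal.ofReal (t ^ (1 / q)) * ‖fderiv ℝ u (hyperplaneContraction a b t x)‖ₑ ^ p) ∂μ := by
        refine setLIntegral_mono' hA fun x hx => ?_
        rw [← ENNReal.ofReal_rpow_of_nonneg (div_nonneg (abs_nonneg _) (hpos x hx).le) hp.le]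
        have hm : Measurable fun t => ‖fderiv ℝ u (hyperplaneContraction a b t x)‖ₑ :=
          (hcont.comp (hTc.comp (by fun_prop : Continuous fun t : ℝ => (x, t)))).enorm.measurable
        exact (ENNReal.rpow_le_rpow (enorm_div_le_lintegral_hyperplaneContraction ha hu hu0
          (hpos x hx)) hp.le).trans (rpow_lintegral_Ioc_zero_one_le hpq hm)
    _ = ENNReal.ofReal q ^ (p - 1) * ∫⁻ t in Set.Ioc (0 : ℝ) 1, ENNReal.ofReal (t ^ (1 / q)) *
          ∫⁻ x in A, ‖fderiv ℝ u (hyperplaneContraction a b t x)‖ₑ ^ p ∂μ := by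
        rw [lintegral_const_mul' _ _ (ENNReal.rpow_ne_top_of_nonneg
          (by linarith [hpq.lt]) ENNReal.ofReal_ne_top), lintegral_lintegral_swap]
        · simp_rw [lintegral_const_mul' _ _ ENNReal.ofReal_ne_top]
        · exact ((by fun_prop : Measurable fun z : E × ℝ => ENNReal.ofReal (z.2 ^ (1 / q))).mul
            (hGm.pow_const p)).aemeasurable
    _ ≤ ENNReal.ofReal q ^ (p - 1) * ∫⁻ t in Set.Ioc (0 : ℝ) 1,
          ENNReal.ofReal (t ^ (-(1 / p))) * I := by
        refine mul_le_mul_right (setLIntegral_mono' measurableSet_Ioc fun t ht => ?_) _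
        refine (mul_le_mul_right (setLIntegral_comp_hyperplaneContraction_le μ ha ht.1 hA (hAT t ht)
          (F := fun x => ‖fderiv ℝ u x‖ₑ ^ p) (hcont.enorm.measurable.pow_const p)) _).trans_eq ?_
        rw [← mul_assoc, ← ENNReal.ofReal_mul (rpow_nonneg ht.1.le _), ← rpow_neg_one,
          ← rpow_add ht.1]
        congr 3
        linarith
    _ = ENNReal.ofReal q ^ p * I := by
        have hp1 : 1 / p < 1 := (div_lt_one hp).2 hpq.lt
        rw [lintegral_mul_const _ (by fun_prop), lintegral_Ioc_zero_one_rpow (by linarith),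
          ← mul_assoc]
        have : 1 / (-(1 / p) + 1) = q := by rw [hpi]; field_simp; ring
        rw [this]
        congr 1
        conv_lhs => rw [← ENNReal.rpow_one (ENNReal.ofReal q), ← ENNReal.rpow_mul, one_mul]
        rw [← ENNReal.rpow_add _ _ (by simpa using hq) ENNReal.ofReal_ne_top]
        ring_nf

end Halfspace

section Convex

variable {E : Type*} [NormedAddCommGroup E] [InnerProductSpace ℝ E] [FiniteDimensional ℝ E]

theorem exists_supporting_hyperplane_le_infDist {Ω : Set E} (hopen : IsOpen Ω)
    (hproper : Ω ≠ Set.univ) (hconv : Convex ℝ Ω) {x : E} (hx : x ∈ Ω) :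
    ∃ (a : E) (b : ℝ), ‖a‖ = 1 ∧ (∀ z ∈ Ω, 0 < inner ℝ a z + b) ∧
      inner ℝ a x + b ≤ Metric.infDist x Ωᶜ := by
  obtain ⟨y, hy, hxy⟩ := hopen.isClosed_compl.exists_infDist_eq_dist
    (Set.nonempty_compl.2 hproper) x
  obtain ⟨f, hf⟩ := geometric_hahn_banach_open_point hconv hopen hy
  set v := (InnerProductSpace.toDual ℝ E).symm f
  have hfv (z : E) : f z = inner ℝ v z := by simp [v]
  have hv : 0 < ‖v‖ := norm_pos_iff.2 fun h => by
    have := hf x hx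
    simp [hfv, h] at this
  have hl (z : E) : inner ℝ (-(‖v‖⁻¹ • v)) z + ‖v‖⁻¹ * inner ℝ v y = ‖v‖⁻¹ * inner ℝ v (y - z) := by
    rw [inner_neg_left, real_inner_smul_left, inner_sub_right]; ring
  refine ⟨-(‖v‖⁻¹ • v), ‖v‖⁻¹ * inner ℝ v y, ?_, fun z hz => ?_, ?_⟩
  · rw [norm_neg, norm_smul, norm_inv, norm_norm, inv_mul_cancel₀ hv.ne']
  · rw [hl, inner_sub_right, ← hfv, ← hfv]
    exact mul_pos (inv_pos.2 hv) (sub_pos.2 (hf z hz))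
  · rw [hl, hxy, dist_comm, dist_eq_norm, inv_mul_le_iff₀ hv]
    exact real_inner_le_norm _ _

theorem exists_seq_supporting_hyperplane {Ω : Set E} (hopen : IsOpen Ω) (hne : Ω.Nonempty)
    (hproper : Ω ≠ Set.univ) (hconv : Convex ℝ Ω) :
    ∃ (a : ℕ → E) (b : ℕ → ℝ), (∀ i, ‖a i‖ = 1) ∧
      (∀ i, ∀ z ∈ Ω, 0 < inner ℝ (a i) z + b i) ∧
      ∀ x ∈ Ω, ∀ δ > 0, ∃ i, inner ℝ (a i) x + b i < Metric.infDist x Ωᶜ + δ := by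
  have : Nonempty Ω := hne.to_subtype
  choose a b ha hpos hle using fun i : ℕ => exists_supporting_hyperplane_le_infDist hopen hproper
    hconv (TopologicalSpace.denseSeq Ω i).2
  refine ⟨a, b, ha, hpos, fun x hx δ hδ => ?_⟩
  obtain ⟨i, hi⟩ := (TopologicalSpace.denseRange_denseSeq Ω).exists_dist_lt ⟨x, hx⟩ (half_pos hδ)
  refine ⟨i, ?_⟩
  set y : E := (TopologicalSpace.denseSeq Ω i : E)
  replace hi : dist x y < δ / 2 := hi
  have h1 : inner ℝ (a i) x - inner ℝ (a i) y ≤ dist x y := by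
    rw [← inner_sub_right, dist_eq_norm]
    simpa [ha i] using real_inner_le_norm (a i) (x - y)
  have h2 : Metric.infDist y Ωᶜ ≤ Metric.infDist x Ωᶜ + dist y x :=
    Metric.infDist_le_infDist_add_dist
  rw [dist_comm] at h2
  linarith [hle i]

variable [MeasurableSpace E] [BorelSpace E] (μ : Measure E) [μ.IsAddHaarMeasure]

/-- Hardy's inequality on a polyhedron, with the distance to the nearest face. -/
theorem lintegral_hardy_polyhedron {p q : ℝ} (hpq : p.HolderConjugate q)
    {ι : Type*} [Finite ι] [Nonempty ι] [LinearOrder ι] {a : ι → E} (ha : ∀ i, ‖a i‖ = 1)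
    {b : ι → ℝ} {u : E → ℝ} (hu : ContDiff ℝ 1 u)
    (hu0 : ∀ i x, inner ℝ (a i) x + b i = 0 → u x = 0) :
    ∫⁻ x in {x | ∀ i, 0 < inner ℝ (a i) x + b i},
        ⨆ i, ENNReal.ofReal ((|u x| / (inner ℝ (a i) x + b i)) ^ p) ∂μ ≤
      ENNReal.ofReal q ^ p * ∫⁻ x, ‖fderiv ℝ u x‖ₑ ^ p ∂μ := by
  have hp := hpq.pos
  let l : ι → E → ℝ := fun i x => inner ℝ (a i) x + b i
  have hlc (i : ι) : Continuous (l i) := by unfold l; fun_prop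
  let A : ι → Set E := fun i => {x | 0 < l i x ∧ ∀ j, l i x ≤ l j x ∧ (j < i → l i x < l j x)}
  have hAm (i : ι) : MeasurableSet (A i) := by
    have : A i = {x | 0 < l i x} ∩
        ⋂ j, ({x | l i x ≤ l j x} ∩ ⋂ (_ : j < i), {x | l i x < l j x}) := by
      ext x; simp [A]
    rw [this]
    exact (measurableSet_lt measurable_const (hlc i).measurable).inter <| .iInter fun j =>
      (measurableSet_le (hlc i).measurable (hlc j).measurable).inter <| .iInter fun _ =>
        measurableSet_lt (hlc i).measurable (hlc j).measurable
  have hdisj : Pairwise (Function.onFun Disjoint A) := by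
    intro i j hij
    refine Set.disjoint_left.2 fun x hi hj => ?_
    rcases hij.lt_or_gt with h | h
    · exact absurd ((hj.2 i).2 h) (hi.2 j).1.not_gt
    · exact absurd ((hi.2 j).2 h) (hj.2 i).1.not_gt
  have hcover : {x | ∀ i, 0 < l i x} = ⋃ i, A i := by
    ext x
    simp only [Set.mem_ofPred_eq, Set.mem_iUnion]
    refine ⟨fun hx => ?_, fun ⟨i, hi⟩ j => hi.1.trans_le (hi.2 j).1⟩
    obtain ⟨i, hi⟩ := Finite.exists_min fun i => toLex (l i x, i)
    refine ⟨i, hx i, fun j => ?_⟩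
    rcases Prod.Lex.toLex_le_toLex.1 (hi j) with h | h
    · exact ⟨h.le, fun _ => h⟩
    · exact ⟨h.1.le, fun hji => absurd h.2 hji.not_ge⟩
  have hAT (i : ι) : ∀ t ∈ Set.Ioc (0 : ℝ) 1, ∀ x ∈ A i,
      hyperplaneContraction (a i) (b i) t x ∈ A i := by
    intro t ht x hx
    have hi : l i (hyperplaneContraction (a i) (b i) t x) = t * l i x :=
      inner_hyperplaneContraction (ha i) _ _ _
    have hs : 0 ≤ (1 - t) * l i x := mul_nonneg (sub_nonneg.2 ht.2) hx.1.le
    have hj (j : ι) : l j x - (1 - t) * l i x ≤ l j (hyperplaneContraction (a i) (b i) t x) := by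
      have h1 : inner ℝ (a j) (a i) ≤ 1 := by
        simpa [ha] using real_inner_le_norm (a j) (a i)
      have h2 : l j (hyperplaneContraction (a i) (b i) t x) =
          l j x - (1 - t) * l i x * inner ℝ (a j) (a i) := by
        simp only [l, hyperplaneContraction, inner_sub_right, real_inner_smul_right]; ring
      rw [h2]
      linarith [mul_le_mul_of_nonneg_left h1 hs]
    refine ⟨hi ▸ mul_pos ht.1 hx.1, fun j => ⟨?_, fun hji => ?_⟩⟩
    · linarith [hj j, (hx.2 j).1]
    · linarith [hj j, (hx.2 j).2 hji]
  change ∫⁻ x in {x | ∀ i, 0 < l i x}, ⨆ i, ENNReal.ofReal ((|u x| / l i x) ^ p) ∂μ ≤ _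
  have : Countable ι := Finite.to_countable
  rw [hcover, lintegral_iUnion hAm hdisj]
  calc _ ≤ ∑' i, ENNReal.ofReal q ^ p * ∫⁻ x in A i, ‖fderiv ℝ u x‖ₑ ^ p ∂μ := by
        refine ENNReal.tsum_le_tsum fun i => ?_
        refine le_trans (setLIntegral_mono' (hAm i) fun x hx => iSup_le fun j => ?_)
          (lintegral_hardy_of_hyperplaneContraction_mem μ hpq (ha i) (hAm i) (fun x hx => hx.1)
            (hAT i) hu (hu0 i))
        refine ENNReal.ofReal_le_ofReal (rpow_le_rpow ?_ ?_ hp.le)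
        · exact div_nonneg (abs_nonneg _) (hx.1.le.trans (hx.2 j).1)
        · exact div_le_div_of_nonneg_left (abs_nonneg _) hx.1 (hx.2 j).1
    _ = ENNReal.ofReal q ^ p * ∫⁻ x in ⋃ i, A i, ‖fderiv ℝ u x‖ₑ ^ p ∂μ := by
        rw [ENNReal.tsum_mul_left, lintegral_iUnion hAm hdisj]
    _ ≤ _ := mul_le_mul_right (setLIntegral_le_lintegral _ _) _

/-- Hardy's inequality on a convex domain, in terms of lower Lebesgue integrals. -/
theorem lintegral_hardy_convex {p q : ℝ} (hpq : p.HolderConjugate q) {Ω : Set E}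
    (hopen : IsOpen Ω) (hne : Ω.Nonempty) (hproper : Ω ≠ Set.univ) (hconv : Convex ℝ Ω)
    {u : E → ℝ} (hu : ContDiff ℝ 1 u) (hu0 : ∀ x ∉ Ω, u x = 0) :
    ∫⁻ x in Ω, ENNReal.ofReal (|u x| ^ p / Metric.infDist x Ωᶜ ^ p) ∂μ ≤
      ENNReal.ofReal q ^ p * ∫⁻ x, ‖fderiv ℝ u x‖ₑ ^ p ∂μ := by
  have hp := hpq.pos
  obtain ⟨a, b, ha, hpos, hinf⟩ := exists_seq_supporting_hyperplane hopen hne hproper hconv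
  let F : ℕ → E → ENNReal := fun i x => ENNReal.ofReal ((|u x| / (inner ℝ (a i) x + b i)) ^ p)
  have huc := hu.continuous
  have hFm (i : ℕ) : Measurable (F i) := by unfold F; fun_prop
  have hd {x : E} (hx : x ∈ Ω) : 0 < Metric.infDist x Ωᶜ :=
    (hopen.isClosed_compl.notMem_iff_infDist_pos (Set.nonempty_compl.2 hproper)).1 (by simpa)
  have hle : ∀ x ∈ Ω, ENNReal.ofReal (|u x| ^ p / Metric.infDist x Ωᶜ ^ p) ≤
      ⨆ n : ℕ, ⨆ i : Fin (n + 1), F i x := by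
    intro x hx
    have hdx := hd hx
    have htend : Filter.Tendsto
        (fun δ : ℝ => ENNReal.ofReal ((|u x| / (Metric.infDist x Ωᶜ + δ)) ^ p))
        (nhdsWithin 0 (Set.Ioi 0))
        (nhds (ENNReal.ofReal ((|u x| / (Metric.infDist x Ωᶜ + 0)) ^ p))) := by
      refine (ENNReal.continuous_ofReal.continuousAt.comp ?_ :
        ContinuousAt (ENNReal.ofReal ∘ fun δ : ℝ => (|u x| / (Metric.infDist x Ωᶜ + δ)) ^ p)
          0).continuousWithinAt
      refine ContinuousAt.rpow_const ?_ (Or.inr hp.le)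
      exact continuousAt_const.div (by fun_prop) (by simpa using hdx.ne')
    rw [add_zero, div_rpow (abs_nonneg _) hdx.le] at htend
    refine le_of_tendsto htend ?_
    filter_upwards [self_mem_nhdsWithin] with δ hδ
    obtain ⟨i, hi⟩ := hinf x hx δ hδ
    refine le_iSup_of_le i (le_iSup_of_le (Fin.last i) ?_)
    refine ENNReal.ofReal_le_ofReal (rpow_le_rpow ?_ ?_ hp.le)
    · exact div_nonneg (abs_nonneg _) (add_pos hdx hδ).le
    · exact div_le_div_of_nonneg_left (abs_nonneg _) (hpos i x hx) hi.le
  refine (setLIntegral_mono' hopen.measurableSet hle).trans ?_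
  rw [lintegral_iSup (f := fun (n : ℕ) x => ⨆ i : Fin (n + 1), F i x)
    (fun n => Measurable.iSup fun i => hFm i)]
  · have hsub (n : ℕ) : Ω ⊆ {x | ∀ i : Fin (n + 1), 0 < inner ℝ (a i) x + b i} :=
      fun x hx i => hpos i x hx
    refine iSup_le fun n => le_trans (lintegral_mono_set (hsub n))
      (lintegral_hardy_polyhedron μ hpq (ι := Fin (n + 1)) (fun i => ha i) hu fun i x hx =>
        hu0 x fun h => (hpos i x h).ne' hx)
  · intro m n hmn x
    exact iSup_le fun i => le_iSup_of_le (Fin.castLE (by omega) i) le_rfl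

end Convex

/-- **Hardy inequality for convex domains.**
If `p > 1`, `n ≥ 1` and `Ω ⊊ ℝⁿ` is a nonempty open convex set, then for every
smooth compactly supported `u` with support in `Ω`,
`∫_Ω ‖∇u‖^p ≥ ((p-1)/p)^p ∫_Ω |u|^p / d^p`, where `d(x) = dist(x, Ωᶜ)`. -/
theorem hardy_inequality_convex
    (p : ℝ) (hp : 1 < p) (n : ℕ) (hn : 1 ≤ n)
    (Ω : Set (EuclideanSpace ℝ (Fin n)))
    (hopen : IsOpen Ω) (hne : Ω.Nonempty) (hproper : Ω ≠ Set.univ)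
    (hconv : Convex ℝ Ω)
    (u : EuclideanSpace ℝ (Fin n) → ℝ)
    (hu : ContDiff ℝ (⊤ : ℕ∞) u) (hcpt : HasCompactSupport u) (hsupp : tsupport u ⊆ Ω) :
    ((p - 1) / p) ^ p * ∫ x in Ω, |u x| ^ p / Metric.infDist x Ωᶜ ^ p
      ≤ ∫ x in Ω, ‖gradient u x‖ ^ p := by
  have hp0 : 0 < p := zero_lt_one.trans hp
  have hpq : p.HolderConjugate (p / (p - 1)) := (holderConjugate_iff_eq_conjExponent hp).2 rfl
  have hq := hpq.symm.pos
  have hu1 : ContDiff ℝ 1 u := hu.of_le (by norm_cast)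
  have hcont : Continuous (fderiv ℝ u) := hu1.continuous_fderiv one_ne_zero
  have hgrad (x) : ‖gradient u x‖ = ‖fderiv ℝ u x‖ := by simp [gradient]
  simp_rw [hgrad]
  have hzero : ∀ x ∉ Ω, ‖fderiv ℝ u x‖ ^ p = 0 := fun x hx => by
    rw [fderiv_of_notMem_tsupport ℝ fun h => hx (hsupp h), norm_zero, zero_rpow hp0.ne']
  rw [setIntegral_eq_integral_of_forall_compl_eq_zero hzero]
  have hint : Integrable fun x => ‖fderiv ℝ u x‖ ^ p := by
    refine Continuous.integrable_of_hasCompactSupport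
      (hcont.norm.rpow_const fun _ => Or.inr hp0.le) ?_
    exact (hcpt.fderiv ℝ).comp_left (g := fun L => ‖L‖ ^ p) (by simp [hp0.ne'])
  have key := lintegral_hardy_convex volume hpq hopen hne hproper hconv hu1
    fun x hx => image_eq_zero_of_notMem_tsupport fun h => hx (hsupp h)
  have hI : ∫⁻ x, ‖fderiv ℝ u x‖ₑ ^ p = ENNReal.ofReal (∫ x, ‖fderiv ℝ u x‖ ^ p) := by
    rw [ofReal_integral_eq_lintegral_ofReal hint
      (Filter.Eventually.of_forall fun x => rpow_nonneg (norm_nonneg _) _)]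
    simp_rw [← ENNReal.ofReal_rpow_of_nonneg (norm_nonneg _) hp0.le, ofReal_norm]
  rw [hI, ENNReal.ofReal_rpow_of_nonneg hq.le hp0.le,
    ← ENNReal.ofReal_mul (rpow_nonneg hq.le _)] at key
  have hJ : ∫ x in Ω, |u x| ^ p / Metric.infDist x Ωᶜ ^ p ≤
      (p / (p - 1)) ^ p * ∫ x, ‖fderiv ℝ u x‖ ^ p := by
    have huc := hu.continuous
    rw [integral_eq_lintegral_of_nonneg_ae]
    · refine ENNReal.toReal_le_of_le_ofReal (mul_nonneg (rpow_nonneg hq.le _) ?_) key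
      exact integral_nonneg fun x => rpow_nonneg (norm_nonneg _) _
    · exact Filter.Eventually.of_forall fun x => div_nonneg (rpow_nonneg (abs_nonneg _) _)
        (rpow_nonneg Metric.infDist_nonneg _)
    · have := (Metric.continuous_infDist_pt Ωᶜ).measurable
      exact (by fun_prop : Measurable fun x => |u x| ^ p / Metric.infDist x Ωᶜ ^ p
        ).aestronglyMeasurable
  have hc : ((p - 1) / p) ^ p = ((p / (p - 1)) ^ p)⁻¹ := by
    rw [← inv_rpow hq.le, inv_div]
  rw [hc, inv_mul_le_iff₀ (rpow_pos_of_pos hq _)]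
  exact hJ
end

section
/- Let p > 1 and let Ω ⊊ ℝⁿ be a nonempty open connected weakly mean convex set with sup_{x∈Ω} d(x) < ∞. Then there exists a constant D ≥ sup_{Ω} d such that for all u ∈ C_c^∞(Ω): ∫_Ω ‖∇u‖^p dx ≥ ((p-1)/p)^p ∫_Ω |u|^p/d^p dx + ((p-1)/(2p)) ((p-1)/p)^{p-2} Σ_{k=1}^{∞} ∫_Ω (|u|^p/d^p) X₁(d/D)² X₂(d/D)² ⋯ X_k(d/D)² dx. -/
open MeasureTheory Real
open scoped RealInnerProductSpace

/-- The iterated logarithmic functions: `X 1 t = (1 - log t)⁻¹`,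
`X (k+1) t = X 1 (X k t)`.  (`X 0` is the identity.) -/
noncomputable def iterLog : ℕ → ℝ → ℝ :=
  fun k => (fun s => (1 - Real.log s)⁻¹)^[k]

lemma iterLog_succ (k : ℕ) (s : ℝ) : iterLog (k + 1) s = iterLog k (1 - log s)⁻¹ := rfl

lemma inv_one_sub_log_mem_Ioo {s : ℝ} (hs : s ∈ Set.Ioo (0 : ℝ) 1) :
    (1 - log s)⁻¹ ∈ Set.Ioo (0 : ℝ) 1 := by
  have h := log_neg hs.1 hs.2
  exact ⟨by have : 0 < 1 - log s := by linarith
            positivity, inv_lt_one_of_one_lt₀ (by linarith)⟩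

lemma iterLog_pos (k : ℕ) {s : ℝ} (hs : s ∈ Set.Ioo (0 : ℝ) 1) : 0 < iterLog k s := by
  induction k generalizing s with
  | zero => exact hs.1
  | succ k ih => exact ih (inv_one_sub_log_mem_Ioo hs)

lemma hasDerivAt_inv_one_sub_log {s : ℝ} (hs : s ∈ Set.Ioo (0 : ℝ) 1) :
    HasDerivAt (fun s => (1 - log s)⁻¹) ((1 - log s)⁻¹ ^ 2 / s) s := by
  have h := log_neg hs.1 hs.2
  have h1 : 1 - log s ≠ 0 := by linarith
  refine (((hasDerivAt_log hs.1.ne').const_sub 1).inv h1).congr_deriv ?_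
  field_simp

/-- Partial sums of the series `∑ₖ X₁^r ⋯ Xₖ^r`. -/
noncomputable def iterLogSum (r K : ℕ) (s : ℝ) : ℝ :=
  ∑ k ∈ Finset.range K, ∏ j ∈ Finset.Icc 1 (k + 1), iterLog j s ^ r

lemma iterLogSum_zero (r : ℕ) (s : ℝ) : iterLogSum r 0 s = 0 := rfl

lemma prod_iterLog_succ (r k : ℕ) (s : ℝ) :
    ∏ j ∈ Finset.Icc 1 (k + 1), iterLog j s ^ r =
      (1 - log s)⁻¹ ^ r * ∏ j ∈ Finset.Icc 1 k, iterLog j (1 - log s)⁻¹ ^ r := by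
  have h : ∀ m t, ∏ j ∈ Finset.Icc 1 m, iterLog j t ^ r =
      ∏ j ∈ Finset.range m, iterLog (j + 1) t ^ r := by
    intro m t
    induction m with
    | zero => simp
    | succ m ih => rw [Finset.prod_Icc_succ_top (by omega), ih, Finset.prod_range_succ]
  rw [h, h, Finset.prod_range_succ', mul_comm]
  rfl

lemma iterLogSum_succ (r K : ℕ) (s : ℝ) :
    iterLogSum r (K + 1) s =
      (1 - log s)⁻¹ ^ r * (1 + iterLogSum r K (1 - log s)⁻¹) := by
  simp only [iterLogSum]
  simp_rw [prod_iterLog_succ r _ s]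
  rw [← Finset.mul_sum, Finset.sum_range_succ']
  simp [add_comm]

lemma iterLogSum_nonneg (r K : ℕ) {s : ℝ} (hs : s ∈ Set.Ioo (0 : ℝ) 1) :
    0 ≤ iterLogSum r K s :=
  Finset.sum_nonneg fun _ _ => Finset.prod_nonneg fun j _ => (pow_pos (iterLog_pos j hs) r).le

lemma continuousAt_iterLog (k : ℕ) {s : ℝ} (hs : s ∈ Set.Ioo (0 : ℝ) 1) :
    ContinuousAt (iterLog k) s := by
  induction k generalizing s with
  | zero => exact continuousAt_id
  | succ k ih =>
    exact ContinuousAt.comp (f := fun s => (1 - log s)⁻¹) (ih (inv_one_sub_log_mem_Ioo hs))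
      (hasDerivAt_inv_one_sub_log hs).continuousAt

lemma continuousAt_prod_iterLog (r k : ℕ) {s : ℝ} (hs : s ∈ Set.Ioo (0 : ℝ) 1) :
    ContinuousAt (fun s => ∏ j ∈ Finset.Icc 1 k, iterLog j s ^ r) s :=
  tendsto_finsetProd _ fun j _ => (continuousAt_iterLog j hs).pow r

lemma continuousAt_iterLogSum (r K : ℕ) {s : ℝ} (hs : s ∈ Set.Ioo (0 : ℝ) 1) :
    ContinuousAt (iterLogSum r K) s :=
  tendsto_finsetSum _ fun _ _ => continuousAt_prod_iterLog r _ hs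

lemma hasDerivAt_iterLogSum_one (K : ℕ) {s : ℝ} (hs : s ∈ Set.Ioo (0 : ℝ) 1) :
    HasDerivAt (iterLogSum 1 K) ((iterLogSum 1 K s ^ 2 + iterLogSum 2 K s) / 2 / s) s := by
  induction K generalizing s with
  | zero => simpa [iterLogSum_zero] using! hasDerivAt_const s (0 : ℝ)
  | succ K ih =>
    have hX := hasDerivAt_inv_one_sub_log hs
    have hX' := inv_one_sub_log_mem_Ioo hs
    have h : iterLogSum 1 (K + 1) = fun s => (1 - log s)⁻¹ *
        (1 + iterLogSum 1 K (1 - log s)⁻¹) := by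
      funext s; rw [iterLogSum_succ, pow_one]
    have hc := (ih hX').comp s hX
    rw [h, iterLogSum_succ]
    refine (hX.mul (hc.const_add 1)).congr_deriv ?_
    have hs0 := hs.1.ne'
    have hx0 := hX'.1.ne'
    simp only [Function.comp]
    generalize (1 - log s)⁻¹ = x at *
    field_simp
    ring

lemma iterLogSum_one_le (K : ℕ) {s : ℝ} (hs : s ∈ Set.Ioo (0 : ℝ) 1) :
    iterLogSum 1 K s ≤ 2 / (-log s) := by
  induction K generalizing s with
  | zero =>
    have h := log_neg hs.1 hs.2
    rw [iterLogSum_zero]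
    exact div_nonneg zero_le_two (by linarith)
  | succ K ih =>
    have h := ih (inv_one_sub_log_mem_Ioo hs)
    have hl : 0 < -log s := by linarith [log_neg hs.1 hs.2]
    rw [iterLogSum_succ, pow_one]
    rw [log_inv, neg_neg] at h
    have he : 1 - log s = 1 + -log s := by ring
    rw [he] at h ⊢
    generalize -log s = L at *
    have h2 := le_log_one_add_of_nonneg hl.le
    have h3 : 2 / log (1 + L) ≤ (L + 2) / L := by
      rw [div_le_div_iff₀ (lt_of_lt_of_le (by positivity) h2) hl]
      rw [div_le_iff₀ (by positivity)] at h2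
      linarith
    calc (1 + L)⁻¹ * (1 + iterLogSum 1 K (1 + L)⁻¹)
        ≤ (1 + L)⁻¹ * (1 + (L + 2) / L) := by gcongr; linarith
      _ = 2 / L := by field_simp; ring

lemma iterLogSum_one_sq_le (K : ℕ) {s : ℝ} (hs : s ∈ Set.Ioo (0 : ℝ) 1) (hs2 : 2 ≤ -log s) :
    iterLogSum 1 K s ^ 2 ≤ 9 * iterLogSum 2 K s := by
  cases K with
  | zero => simp [iterLogSum_zero]
  | succ K =>
    have h1 := iterLogSum_one_le (K + 1) hs
    have h0 := iterLogSum_nonneg 1 (K + 1) hs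
    have h2 := iterLogSum_nonneg 2 K (inv_one_sub_log_mem_Ioo hs)
    have hx := (inv_one_sub_log_mem_Ioo hs).1
    have h3 : iterLogSum 1 (K + 1) s ≤ 3 * (1 - log s)⁻¹ := by
      refine h1.trans ?_
      rw [← div_eq_mul_inv, div_le_div_iff₀ (by linarith) (by linarith)]
      linarith
    rw [iterLogSum_succ 2]
    nlinarith [mul_nonneg (sq_nonneg (1 - log s)⁻¹) h2]

lemma one_sub_rpow_le {q : ℝ} (hq : 1 < q) {g : ℝ} (h0 : 0 ≤ g) (h1 : g ≤ 1 / 2) :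
    (1 - g) ^ q ≤ 1 - q * g + q * (q - 1) / 2 * g ^ 2 + q * (q - 1) / 3 * g ^ 3 := by
  have hd : ∀ (r : ℝ), ∀ x ∈ Set.Icc (0 : ℝ) (1 / 2),
      HasDerivAt (fun x : ℝ => (1 - x) ^ r) (-(r * (1 - x) ^ (r - 1))) x := by
    intro r x hx
    have h : (0 : ℝ) < 1 - x := by linarith [hx.2]
    refine (((hasDerivAt_id x).const_sub 1).rpow_const (p := r) (Or.inl h.ne')).congr_deriv ?_
    simp
  have mono : ∀ {F F' : ℝ → ℝ}, (∀ x ∈ Set.Icc (0 : ℝ) (1 / 2), HasDerivAt F (F' x) x) →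
      (∀ x ∈ Set.Icc (0 : ℝ) (1 / 2), 0 ≤ F' x) → F 0 = 0 →
      ∀ x ∈ Set.Icc (0 : ℝ) (1 / 2), 0 ≤ F x := by
    intro F F' hF hF' hF0 x hx
    have : MonotoneOn F (Set.Icc (0 : ℝ) (1 / 2)) :=
      monotoneOn_of_hasDerivWithinAt_nonneg (convex_Icc _ _)
        (fun x hx => (hF x hx).continuousAt.continuousWithinAt)
        (fun x hx => (hF x (interior_subset hx)).hasDerivWithinAt)
        (fun x hx => hF' x (interior_subset hx))
    have h := this ⟨le_rfl, by norm_num⟩ hx hx.1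
    rwa [hF0] at h
  have key1 : ∀ x ∈ Set.Icc (0 : ℝ) (1 / 2),
      0 ≤ -1 + (q - 1) * x + (q - 1) * x ^ 2 + (1 - x) ^ (q - 1) := by
    refine mono (F' := fun x => (q - 1) + (q - 1) * (2 * x) - (q - 1) * (1 - x) ^ (q - 2)) ?_ ?_ ?_
    · intro x hx
      have := ((((hasDerivAt_id x).const_mul (q - 1)).const_add (-1)).add
        (((hasDerivAt_pow 2 x)).const_mul (q - 1))).add (hd (q - 1) x hx)
      refine this.congr_deriv ?_
      have : q - 1 - 1 = q - 2 := by ring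
      rw [this]; simp; ring
    · intro x hx
      have h : (0 : ℝ) < 1 - x := by linarith [hx.2]
      have h2 : (1 - x) ^ (q - 2) ≤ 1 + 2 * x := by
        calc (1 - x) ^ (q - 2) ≤ (1 - x) ^ (-1 : ℝ) :=
              rpow_le_rpow_of_exponent_ge h (by linarith [hx.1]) (by linarith)
          _ = (1 - x)⁻¹ := rpow_neg_one _
          _ ≤ 1 + 2 * x := by
              rw [inv_le_iff_one_le_mul₀ h]; nlinarith [hx.1, hx.2]
      nlinarith
    · simp
  have key2 := mono (F := fun x => 1 - q * x + q * (q - 1) / 2 * x ^ 2 +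
      q * (q - 1) / 3 * x ^ 3 - (1 - x) ^ q)
    (F' := fun x => q * (-1 + (q - 1) * x + (q - 1) * x ^ 2 + (1 - x) ^ (q - 1))) ?_ ?_ ?_ g ⟨h0, h1⟩
  · linarith
  · intro x hx
    have := (((((hasDerivAt_id x).const_mul q).const_sub 1).add
        ((hasDerivAt_pow 2 x).const_mul (q * (q - 1) / 2))).add
        ((hasDerivAt_pow 3 x).const_mul (q * (q - 1) / 3))).sub (hd q x hx)
    refine this.congr_deriv ?_
    simp; ring
  · intro x hx
    exact mul_nonneg (by linarith) (key1 x hx)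
  · simp

lemma hardy_potential_ge {p e S : ℝ} (hp : 1 < p) (he : 0 ≤ e) (he1 : e ≤ 1 / 100)
    (hS : e ^ 2 ≤ 9 * S) :
    (p - 1) / p + S / 2 ≤ (p - 1) * (1 - (e + 9 * e ^ 2)) + (1 + 18 * e) * ((e ^ 2 + S) / 2)
      - (p - 1) * ((p - 1) / p) * (1 - (e + 9 * e ^ 2)) ^ (p / (p - 1)) := by
  have hp1 : 0 < p - 1 := by linarith
  have hp0 : 0 < p := by linarith
  have hq : 1 < p / (p - 1) := by rw [lt_div_iff₀ hp1]; linarith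
  have h := mul_le_mul_of_nonneg_left
    (one_sub_rpow_le hq (g := e + 9 * e ^ 2) (by positivity) (by nlinarith))
    (show 0 ≤ (p - 1) * ((p - 1) / p) by positivity)
  have hid : ∀ g : ℝ, (p - 1) * ((p - 1) / p) * (1 - p / (p - 1) * g +
      p / (p - 1) * (p / (p - 1) - 1) / 2 * g ^ 2 + p / (p - 1) * (p / (p - 1) - 1) / 3 * g ^ 3) =
      (p - 1) - (p - 1) / p - (p - 1) * g + g ^ 2 / 2 + g ^ 3 / 3 := by
    intro g; field_simp; ring
  rw [hid] at h
  suffices hm : 0 ≤ e * (9 * S - e ^ 2 * (81 * e / 2 + (1 + 9 * e) ^ 3 / 3)) by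
    nlinarith
  refine mul_nonneg he ?_
  have : 81 * e / 2 + (1 + 9 * e) ^ 3 / 3 ≤ 1 := by
    have : (1 + 9 * e) ^ 3 ≤ (109 / 100) ^ 3 := by gcongr; linarith
    linarith
  nlinarith [sq_nonneg e]

lemma norm_gradient_eq {E : Type*} [NormedAddCommGroup E] [InnerProductSpace ℝ E] [CompleteSpace E]
    (f : E → ℝ) (x : E) : ‖gradient f x‖ = ‖fderiv ℝ f x‖ :=
  (InnerProductSpace.toDual ℝ E).symm.norm_map _

lemma exists_contDiffBump_rOut_eq {E : Type*} [NormedAddCommGroup E] {r : ℝ} (hr : 0 < r) :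
    ∃ β : ContDiffBump (0 : E), β.rOut = r ∧ β.rOut ≤ 2 * β.rIn :=
  ⟨⟨r / 2, r, by positivity, by linarith⟩, rfl, by simp; linarith⟩

/-- At a point of differentiability in `Ω`, the distance to the complement has unit gradient. -/
lemma norm_gradient_infDist_compl {E : Type*} [NormedAddCommGroup E]
    [InnerProductSpace ℝ E] [FiniteDimensional ℝ E] {Ω : Set E} (hΩ : IsOpen Ω) (hne : Ωᶜ.Nonempty) {x : E}
    (hx : x ∈ Ω) (hd : DifferentiableAt ℝ (fun y => Metric.infDist y Ωᶜ) x) :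
    ‖gradient (fun y => Metric.infDist y Ωᶜ) x‖ = 1 := by
  have := FiniteDimensional.proper ℝ E
  rw [norm_gradient_eq]
  have hle : ‖fderiv ℝ (fun y => Metric.infDist y Ωᶜ) x‖ ≤ 1 := by
    simpa using norm_fderiv_le_of_lipschitz ℝ (x₀ := x) (Metric.lipschitz_infDist_pt Ωᶜ)
  refine le_antisymm hle ?_
  obtain ⟨y, hy, hxy⟩ := hΩ.isClosed_compl.exists_infDist_eq_dist hne x
  have hpos : 0 < Metric.infDist x Ωᶜ :=
    (hΩ.isClosed_compl.notMem_iff_infDist_pos hne).1 (fun h => h hx)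
  have hline : HasDerivAt (fun t : ℝ => Metric.infDist (x + t • (y - x)) Ωᶜ)
      (fderiv ℝ (fun y => Metric.infDist y Ωᶜ) x (y - x)) 0 := by
    have h1 : HasDerivAt (fun t : ℝ => x + t • (y - x)) (y - x) 0 := by
      simpa using ((hasDerivAt_id (0 : ℝ)).smul_const (y - x)).const_add x
    have h2 : HasFDerivAt (fun y => Metric.infDist y Ωᶜ)
        (fderiv ℝ (fun y => Metric.infDist y Ωᶜ) x) (x + (0 : ℝ) • (y - x)) := by
      simpa using hd.hasFDerivAt
    exact h2.comp_hasDerivAt (0 : ℝ) h1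
  have hlin : ∀ t ∈ Set.Icc (0 : ℝ) 1, Metric.infDist (x + t • (y - x)) Ωᶜ =
      (1 - t) * Metric.infDist x Ωᶜ := by
    intro t ht
    refine le_antisymm ?_ ?_
    · refine (Metric.infDist_le_dist_of_mem hy).trans ?_
      have : x + t • (y - x) - y = (1 - t) • (x - y) := by module
      rw [dist_eq_norm, this, norm_smul, hxy, dist_eq_norm,
        Real.norm_of_nonneg (by linarith [ht.2])]
    · have h := Metric.infDist_le_infDist_add_dist (s := Ωᶜ) (x := x) (y := x + t • (y - x))
      have h2 : dist x (x + t • (y - x)) = t * Metric.infDist x Ωᶜ := by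
        rw [dist_eq_norm, hxy, dist_eq_norm, sub_add_cancel_left, norm_neg, norm_smul,
          Real.norm_of_nonneg ht.1, norm_sub_rev]
      linarith
  have hder : HasDerivWithinAt (fun t : ℝ => Metric.infDist (x + t • (y - x)) Ωᶜ)
      (-Metric.infDist x Ωᶜ) (Set.Icc 0 1) 0 := by
    have h : HasDerivWithinAt (fun t : ℝ => (1 - t) * Metric.infDist x Ωᶜ)
        (-Metric.infDist x Ωᶜ) (Set.Icc 0 1) 0 := by
      simpa using (((hasDerivAt_id (0 : ℝ)).const_sub 1).mul_const
        (Metric.infDist x Ωᶜ)).hasDerivWithinAt (s := Set.Icc 0 1)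
    exact h.congr hlin (hlin 0 (by simp))
  have heq := (uniqueDiffOn_Icc (zero_lt_one' ℝ) 0 (by simp)).eq_deriv _
    hline.hasDerivWithinAt hder
  have h3 := (fderiv ℝ (fun y => Metric.infDist y Ωᶜ) x).le_opNorm (y - x)
  rw [heq, norm_neg, Real.norm_of_nonneg hpos.le, ← dist_eq_norm, dist_comm, ← hxy] at h3
  nlinarith

section Mollification

variable {E : Type*} [NormedAddCommGroup E] [InnerProductSpace ℝ E] [FiniteDimensional ℝ E]
  [MeasurableSpace E] [BorelSpace E]

lemma measurable_gradient (f : E → ℝ) : Measurable (gradient f) :=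
  (InnerProductSpace.toDual ℝ E).symm.continuous.measurable.comp (measurable_fderiv ℝ f)

/-- The derivative of the mollification of a Lipschitz function. -/
lemma LipschitzWith.hasFDerivAt_normed_convolution {C : NNReal} {φ : E → ℝ}
    (hφ : LipschitzWith C φ) (β : ContDiffBump (0 : E)) (x : E) :
    HasFDerivAt (convolution (β.normed volume) φ (ContinuousLinearMap.lsmul ℝ ℝ) volume)
      (convolution (β.normed volume) (fderiv ℝ φ) (ContinuousLinearMap.lsmul ℝ ℝ) volume x) x := by
  have hβc : Continuous (β.normed volume) := β.continuous_normed
  refine (hasFDerivAt_integral_of_dominated_loc_of_lip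
    (F := fun x t => ContinuousLinearMap.lsmul ℝ ℝ (β.normed volume t) (φ (x - t)))
    (F' := fun t => ContinuousLinearMap.lsmul ℝ ℝ (β.normed volume t) (fderiv ℝ φ (x - t)))
    (bound := fun t => C * β.normed volume t) Filter.univ_mem ?_ ?_ ?_ ?_ ?_ ?_).2
  · refine Filter.Eventually.of_forall fun y => Continuous.aestronglyMeasurable ?_
    have := hφ.continuous
    simp only [ContinuousLinearMap.lsmul_apply]
    fun_prop
  · refine Continuous.integrable_of_hasCompactSupport ?_ ?_
    · have := hφ.continuous
      simp only [ContinuousLinearMap.lsmul_apply]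
      fun_prop
    · simp only [ContinuousLinearMap.lsmul_apply]
      exact β.hasCompactSupport_normed.smul_right
  · simp only [ContinuousLinearMap.lsmul_apply]
    exact (hβc.measurable.smul ((measurable_fderiv ℝ φ).comp
      (measurable_const.sub measurable_id))).aestronglyMeasurable
  · refine Filter.Eventually.of_forall fun t => LipschitzWith.lipschitzOnWith ?_
    refine LipschitzWith.of_dist_le_mul fun y z => ?_
    have hn := β.nonneg_normed (μ := volume) t
    have h := hφ.dist_le_mul (y - t) (z - t)
    rw [dist_sub_right] at h
    simp only [ContinuousLinearMap.lsmul_apply, Real.coe_nnabs, smul_eq_mul, Real.dist_eq,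
      ← mul_sub, abs_mul, NNReal.abs_eq] at h ⊢
    calc _ ≤ |β.normed volume t| * (C * dist y z) := by gcongr
      _ = _ := by ring
  · exact β.integrable_normed.const_mul _
  · have h := (Measure.measurePreserving_sub_left volume x).quasiMeasurePreserving.ae
      hφ.ae_differentiableAt
    filter_upwards [h] with t ht
    have h1 : HasFDerivAt (fun y => φ (y - t)) (fderiv ℝ φ (x - t)) x :=
      (hasFDerivAt_comp_sub t).2 ht.hasFDerivAt
    exact h1.const_smul (β.normed volume t)

lemma ContDiffBump.norm_normed_convolution_le {F : Type*} [NormedAddCommGroup F]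
    [NormedSpace ℝ F] (β : ContDiffBump (0 : E)) {g : E → F} {C : ℝ} (hg : ∀ x, ‖g x‖ ≤ C) (x : E) :
    ‖convolution (β.normed volume) g (ContinuousLinearMap.lsmul ℝ ℝ) volume x‖ ≤ C := by
  calc _ ≤ ∫ t, β.normed volume t * C := by
        refine norm_integral_le_of_norm_le (β.integrable_normed.mul_const _)
          (Filter.Eventually.of_forall fun t => ?_)
        have hn := β.nonneg_normed (μ := volume) t
        rw [ContinuousLinearMap.lsmul_apply, norm_smul, Real.norm_of_nonneg hn]
        exact mul_le_mul_of_nonneg_left (hg _) hn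
    _ = C := by rw [integral_mul_const, β.integral_normed, one_mul]

lemma tsupport_normed_convolution_subset {F : Type*} [NormedAddCommGroup F]
    [NormedSpace ℝ F] (β : ContDiffBump (0 : E)) {g : E → F} {r : ℝ} (hr : β.rOut ≤ r) :
    tsupport (convolution (β.normed volume) g (ContinuousLinearMap.lsmul ℝ ℝ) volume) ⊆
      Metric.cthickening r (tsupport g) := by
  refine closure_minimal ?_ Metric.isClosed_cthickening
  refine (support_convolution_subset_swap _).trans ?_
  rintro _ ⟨y, hy, z, hz, rfl⟩
  rw [β.support_normed_eq, mem_ball_zero_iff] at hz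
  refine Metric.mem_cthickening_of_dist_le _ y r _ (subset_tsupport g hy) ?_
  simpa using hz.le.trans hr

lemma integrable_of_bounded_of_hasCompactSupport {F : Type*} [NormedAddCommGroup F]
    {f : E → F} (hf : AEStronglyMeasurable f volume)
    (hs : HasCompactSupport f) {C : ℝ} (hC : ∀ x, ‖f x‖ ≤ C) : Integrable f := by
  rw [← integrableOn_iff_integrable_of_support_subset (subset_tsupport f)]
  exact Measure.integrableOn_of_bounded hs.measure_lt_top.ne hf
    (Filter.Eventually.of_forall hC)

/-- If the distributional divergence of a bounded vector field `V` is nonpositive against smooth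
test functions, it is so against Lipschitz test functions. -/
lemma LipschitzWith.integral_inner_gradient_nonneg {Ω : Set E} (hΩ : IsOpen Ω) {V : E → E}
    (hV : Measurable V) (hV1 : ∀ x, ‖V x‖ ≤ 1)
    (hwmc : ∀ φ : E → ℝ, ContDiff ℝ (⊤ : ℕ∞) φ → HasCompactSupport φ → tsupport φ ⊆ Ω →
      (∀ x, 0 ≤ φ x) → 0 ≤ ∫ x in Ω, ⟪V x, gradient φ x⟫)
    {C : NNReal} {φ : E → ℝ} (hφ : LipschitzWith C φ) (hc : HasCompactSupport φ)
    (hs : tsupport φ ⊆ Ω) (h0 : ∀ x, 0 ≤ φ x) :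
    IntegrableOn (fun x => ⟪V x, gradient φ x⟫) Ω ∧ 0 ≤ ∫ x in Ω, ⟪V x, gradient φ x⟫ := by
  have hCb : ∀ x, ‖fderiv ℝ φ x‖ ≤ C := fun x => norm_fderiv_le_of_lipschitz ℝ hφ
  have hcd : HasCompactSupport (fderiv ℝ φ) := hc.fderiv (𝕜 := ℝ)
  have hdint : Integrable (fderiv ℝ φ) :=
    integrable_of_bounded_of_hasCompactSupport (measurable_fderiv ℝ φ).aestronglyMeasurable hcd hCb
  obtain ⟨r, hr, hrΩ⟩ := hc.isCompact.exists_cthickening_subset_open hΩ hs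
  have hK : IsCompact (Metric.cthickening r (tsupport φ)) := hc.isCompact.cthickening
  choose β hβ hβ2 using fun k : ℕ =>
    exists_contDiffBump_rOut_eq (E := E) (r := r / (k + 1)) (by positivity)
  have hβr : ∀ k, (β k).rOut ≤ r := fun k => by
    rw [hβ]; exact div_le_self hr.le (by linarith [k.cast_nonneg (α := ℝ)])
  have hβ0 : Filter.Tendsto (fun k => (β k).rOut) Filter.atTop (nhds 0) := by
    simp_rw [hβ]
    simpa [div_eq_mul_inv] using (tendsto_one_div_add_atTop_nhds_zero_nat (𝕜 := ℝ)).const_mul r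
  set ψ : ℕ → E → ℝ := fun k =>
    convolution ((β k).normed volume) φ (ContinuousLinearMap.lsmul ℝ ℝ) volume with hψ
  have hψt : ∀ k, tsupport (ψ k) ⊆ Metric.cthickening r (tsupport φ) := fun k =>
    tsupport_normed_convolution_subset (β k) (hβr k)
  have hψd : ∀ k x, fderiv ℝ (ψ k) x = convolution ((β k).normed volume) (fderiv ℝ φ)
      (ContinuousLinearMap.lsmul ℝ ℝ) volume x := fun k x =>
    (hφ.hasFDerivAt_normed_convolution (β k) x).fderiv
  have hinner : ∀ (f : E → ℝ) x, ⟪V x, gradient f x⟫ = fderiv ℝ f x (V x) := fun f x => by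
    rw [real_inner_comm, inner_gradient_left]
  have hnn : ∀ k, 0 ≤ ∫ x in Ω, ⟪V x, gradient (ψ k) x⟫ := by
    intro k
    refine hwmc (ψ k) ?_ (HasCompactSupport.of_support_subset_isCompact hK
      ((subset_tsupport _).trans (hψt k))) ((hψt k).trans hrΩ) fun x => ?_
    · exact (β k).hasCompactSupport_normed.contDiff_convolution_left _ (β k).contDiff_normed
        hφ.continuous.locallyIntegrable
    · exact integral_nonneg fun t => mul_nonneg ((β k).nonneg_normed t) (h0 _)
  have hmeas : ∀ f : E → ℝ, AEStronglyMeasurable (fun x => ⟪V x, gradient f x⟫)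
      (volume.restrict Ω) := fun f =>
    (hV.inner (measurable_gradient f)).aestronglyMeasurable
  have hbound : ∀ (f : E → ℝ) x, ‖fderiv ℝ f x‖ ≤ C → ‖⟪V x, gradient f x⟫‖ ≤ C := by
    intro f x h
    refine (norm_inner_le_norm _ _).trans ?_
    rw [norm_gradient_eq]
    calc ‖V x‖ * ‖fderiv ℝ f x‖ ≤ 1 * C := by gcongr; exact hV1 x
      _ = C := one_mul _
  have hdom : ∀ f : E → ℝ, tsupport f ⊆ Metric.cthickening r (tsupport φ) →
      (∀ x, ‖fderiv ℝ f x‖ ≤ C) → ∀ x, ‖⟪V x, gradient f x⟫‖ ≤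
        (Metric.cthickening r (tsupport φ)).indicator (fun _ => (C : ℝ)) x := by
    intro f hf hfC x
    by_cases hx : x ∈ Metric.cthickening r (tsupport φ)
    · rw [Set.indicator_of_mem hx]; exact hbound f x (hfC x)
    · rw [Set.indicator_of_notMem hx, hinner, fderiv_of_notMem_tsupport ℝ (fun h => hx (hf h))]
      simp
  have hbint : Integrable ((Metric.cthickening r (tsupport φ)).indicator (fun _ => (C : ℝ)))
      (volume.restrict Ω) := by
    refine Integrable.restrict ?_
    rw [integrable_indicator_iff hK.measurableSet]
    exact integrableOn_const hK.measure_lt_top.ne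
  have hlim : Filter.Tendsto (fun k => ∫ x in Ω, ⟪V x, gradient (ψ k) x⟫) Filter.atTop
      (nhds (∫ x in Ω, ⟪V x, gradient φ x⟫)) := by
    refine tendsto_integral_of_dominated_convergence _ (fun k => hmeas (ψ k)) hbint
      (fun k => Filter.Eventually.of_forall (hdom (ψ k) (hψt k) fun x => ?_)) ?_
    · rw [hψd]; exact (β k).norm_normed_convolution_le hCb x
    · refine ae_restrict_of_ae ?_
      filter_upwards [ContDiffBump.ae_convolution_tendsto_right_of_locallyIntegrable (μ := volume) hβ0
        (Filter.Eventually.of_forall hβ2) hdint.locallyIntegrable] with x hx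
      simp_rw [hinner, hψd]
      exact ((ContinuousLinearMap.apply ℝ ℝ (V x)).continuous.tendsto _).comp hx
  refine ⟨hbint.mono' (hmeas φ) (Filter.Eventually.of_forall
    (hdom φ (Metric.self_subset_cthickening _) hCb)), ge_of_tendsto' hlim hnn⟩

end Mollification

lemma LipschitzWith.exists_mul_of_bounded {E : Type*} [PseudoMetricSpace E] {f g : E → ℝ} {C C' : NNReal} {A B : ℝ}
    (hf : LipschitzWith C f) (hg : LipschitzWith C' g) (hA : ∀ x, |f x| ≤ A) (hB : ∀ x, |g x| ≤ B) :
    ∃ C'', LipschitzWith C'' (fun x => f x * g x) := by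
  refine ⟨(A * C' + B * C).toNNReal, LipschitzWith.of_dist_le_mul fun x y => ?_⟩
  have h1 := hf.dist_le_mul x y
  have h2 := hg.dist_le_mul x y
  rw [Real.dist_eq] at h1 h2 ⊢
  have hA0 : 0 ≤ A := (abs_nonneg _).trans (hA x)
  have hB0 : 0 ≤ B := (abs_nonneg _).trans (hB x)
  calc |f x * g x - f y * g y| = |f x * (g x - g y) + g y * (f x - f y)| := by ring_nf
    _ ≤ |f x| * |g x - g y| + |g y| * |f x - f y| := by
        rw [← abs_mul, ← abs_mul]; exact abs_add_le _ _
    _ ≤ A * (C' * dist x y) + B * (C * dist x y) := by gcongr; exacts [hA x, hB y]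
    _ = (A * C' + B * C) * dist x y := by ring
    _ ≤ _ := by gcongr; exact Real.le_coe_toNNReal _

lemma abs_rpow_sub_two_mul_abs {p : ℝ} (hp : 1 < p) (a : ℝ) :
    |a| ^ (p - 2) * |a| = |a| ^ (p - 1) := by
  rcases (abs_nonneg a).eq_or_lt with h | h
  · rw [← h, mul_zero, zero_rpow (by linarith)]
  · rw [← rpow_add_one h.ne']; congr 1; ring

lemma young_weighted {p f a b : ℝ} (hp : 1 < p) (hf : 0 ≤ f) (ha : 0 ≤ a) (hb : 0 ≤ b) :
    p * f * a ^ (p - 1) * b ≤ b ^ p + (p - 1) * f ^ (p / (p - 1)) * a ^ p := by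
  have hp1 : 0 < p - 1 := by linarith
  have hp0 : 0 < p := by linarith
  have hpq : p.HolderConjugate (p / (p - 1)) := Real.HolderConjugate.conjExponent hp
  have h := Real.young_inequality_of_nonneg hb (mul_nonneg hf (rpow_nonneg ha (p - 1))) hpq
  rw [mul_rpow hf (rpow_nonneg ha _), ← rpow_mul ha,
    show (p - 1) * (p / (p - 1)) = p by field_simp] at h
  have h2 := mul_le_mul_of_nonneg_left h hp0.le
  have h3 : p * (b ^ p / p + f ^ (p / (p - 1)) * a ^ p / (p / (p - 1))) =
      b ^ p + (p - 1) * f ^ (p / (p - 1)) * a ^ p := by field_simp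
  linarith

lemma HasFDerivAt.abs_rpow {E : Type*} [NormedAddCommGroup E] [NormedSpace ℝ E]
    {p : ℝ} (hp : 1 < p) {u : E → ℝ} {L : E →L[ℝ] ℝ} {x : E}
    (hu : HasFDerivAt u L x) :
    HasFDerivAt (fun x => |u x| ^ p) ((p * |u x| ^ (p - 2) * u x) • L) x :=
  (hasDerivAt_abs_rpow (u x) hp).comp_hasFDerivAt x hu

section Hardy

variable {E : Type*} [NormedAddCommGroup E] [InnerProductSpace ℝ E] [FiniteDimensional ℝ E]
  [MeasurableSpace E] [BorelSpace E]

lemma integrable_mul_of_continuousOn {Ω : Set E} (hΩ : IsOpen Ω) {w v : E → ℝ}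
    (hw : ContinuousOn w Ω) (hv : Continuous v) (hc : HasCompactSupport v)
    (hs : tsupport v ⊆ Ω) : Integrable (fun x => w x * v x) := by
  refine Continuous.integrable_of_hasCompactSupport (continuous_of_tsupport fun x hx => ?_)
    hc.mul_left
  have hxv : x ∈ tsupport v := tsupport_mul_subset_right hx
  exact (hw.continuousAt (hΩ.mem_nhds (hs hxv))).mul hv.continuousAt

/-- The weighted Hardy inequality obtained by testing superharmonicity of the
distance function with `F(d)|u|^p`. -/
lemma integral_hardy_potential_le {p : ℝ} (hp : 1 < p) {Ω : Set E} (hΩ : IsOpen Ω)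
    (hne : Ωᶜ.Nonempty)
    (hwmc : ∀ φ : E → ℝ, ContDiff ℝ (⊤ : ℕ∞) φ → HasCompactSupport φ → tsupport φ ⊆ Ω →
      (∀ x, 0 ≤ φ x) →
      0 ≤ ∫ x in Ω, ⟪gradient (fun y => Metric.infDist y Ωᶜ) x, gradient φ x⟫)
    {M N : ℝ} (hMN : M < N) (hM : ∀ x ∈ Ω, Metric.infDist x Ωᶜ ≤ M) {F F' : ℝ → ℝ}
    (hF : ∀ t ∈ Set.Ioo 0 N, HasDerivAt F (F' t) t) (hF' : ContinuousOn F' (Set.Ioo 0 N))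
    (hF0 : ∀ t ∈ Set.Ioo 0 N, 0 ≤ F t) {u : E → ℝ} (hu : ContDiff ℝ 1 u)
    (hc : HasCompactSupport u) (hs : tsupport u ⊆ Ω) :
    ∫ x in Ω, (-F' (Metric.infDist x Ωᶜ) -
      (p - 1) * F (Metric.infDist x Ωᶜ) ^ (p / (p - 1))) * |u x| ^ p ≤
      ∫ x in Ω, ‖gradient u x‖ ^ p := by
  have hp0 : 0 < p := by linarith
  set d : E → ℝ := fun y => Metric.infDist y Ωᶜ with hd
  have hdlip : LipschitzWith 1 d := Metric.lipschitz_infDist_pt Ωᶜ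
  have hdpos : ∀ x ∈ Ω, 0 < d x := fun x hx =>
    (hΩ.isClosed_compl.notMem_iff_infDist_pos hne).1 (fun h => h hx)
  have hdmem : ∀ x ∈ Ω, d x ∈ Set.Ioo 0 N := fun x hx => ⟨hdpos x hx, (hM x hx).trans_lt hMN⟩
  have hd0 : ∀ x, 0 ≤ d x := fun x => Metric.infDist_nonneg
  have hdM : ∀ x, d x ≤ |M| := by
    intro x
    by_cases hx : x ∈ Ω
    · exact (hM x hx).trans (le_abs_self M)
    · rw [hd]; simp only; rw [Metric.infDist_zero_of_mem (show x ∈ Ωᶜ from hx)]; positivity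
  obtain ⟨δ, hδ, hδu⟩ : ∃ δ > 0, ∀ x ∈ tsupport u, δ ≤ d x := by
    rcases (tsupport u).eq_empty_or_nonempty with h | h
    · exact ⟨1, one_pos, by simp [h]⟩
    · obtain ⟨x, hx, hmin⟩ := hc.isCompact.exists_isMinOn h hdlip.continuous.continuousOn
      exact ⟨d x, hdpos x (hs hx), fun y hy => hmin hy⟩
  set v : E → ℝ := fun x => |u x| ^ p with hv
  have hvC : ContDiff ℝ 1 v := hu.norm_rpow hp
  have hvzero : ∀ x, x ∉ tsupport u → v x = 0 := fun x hx => by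
    simp [hv, image_eq_zero_of_notMem_tsupport hx, zero_rpow hp0.ne']
  have hvs : tsupport v ⊆ tsupport u :=
    closure_minimal (fun x hx => by_contra fun h => hx (hvzero x h)) (isClosed_tsupport u)
  have hvc : HasCompactSupport v := hc.of_isClosed_subset (isClosed_tsupport v) hvs
  have hv0 : ∀ x, 0 ≤ v x := fun x => by positivity
  set I : Set ℝ := Set.Icc (δ / 2) ((M + N) / 2) with hI
  have hIN : I ⊆ Set.Ioo 0 N := fun t ht => ⟨by linarith [ht.1], by linarith [ht.2]⟩
  have hInhds : ∀ x ∈ tsupport u, I ∈ nhds (d x) := fun x hx =>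
    Icc_mem_nhds (by linarith [hδu x hx]) (by linarith [hM x (hs hx)])
  obtain ⟨C, hC⟩ : ∃ C : ℝ, ∀ t ∈ I, ‖F' t‖ ≤ C :=
    isCompact_Icc.exists_bound_of_continuousOn (hF'.mono hIN)
  have hFlip : LipschitzOnWith C.toNNReal F I :=
    (convex_Icc _ _).lipschitzOnWith_of_nnnorm_hasDerivWithin_le
      (fun t ht => (hF t (hIN ht)).hasDerivWithinAt)
      (fun t ht => NNReal.coe_le_coe.1 ((hC t ht).trans (Real.le_coe_toNNReal C)))
  obtain ⟨G, hG, hGF⟩ := hFlip.extend_real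
  obtain ⟨Cv, hCv⟩ := hvC.lipschitzWith_of_hasCompactSupport hvc one_ne_zero
  obtain ⟨B, hB⟩ := hvc.exists_bound_of_continuous hvC.continuous
  obtain ⟨C', hφlip⟩ := (hG.comp hdlip).exists_mul_of_bounded hCv
    (A := |G 0| + C.toNNReal * |M|) (fun x => by
      have h := hG.dist_le_mul (d x) 0
      rw [Real.dist_eq, Real.dist_eq, sub_zero, abs_of_nonneg (hd0 x)] at h
      have h2 := abs_sub_abs_le_abs_sub (G (d x)) (G 0)
      have h3 : (C.toNNReal : ℝ) * d x ≤ C.toNNReal * |M| := by gcongr; exact hdM x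
      simp only [Function.comp]
      linarith) hB
  set φ : E → ℝ := fun x => (G ∘ d) x * v x with hφ
  have hφs : tsupport φ ⊆ tsupport u := (tsupport_mul_subset_right).trans hvs
  have hGd : ∀ x ∈ tsupport u, G (d x) = F (d x) := fun x hx =>
    (hGF (mem_of_mem_nhds (hInhds x hx))).symm
  have hφ0 : ∀ x, 0 ≤ φ x := by
    intro x
    by_cases hx : x ∈ tsupport u
    · simp only [hφ, Function.comp, hGd x hx]
      exact mul_nonneg (hF0 _ (hdmem x (hs hx))) (hv0 x)
    · simp [hφ, hvzero x hx]
  have hV1 : ∀ x, ‖gradient d x‖ ≤ 1 := fun x => by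
    rw [norm_gradient_eq]; simpa using norm_fderiv_le_of_lipschitz ℝ (x₀ := x) hdlip
  obtain ⟨hint, hnn⟩ := hφlip.integral_inner_gradient_nonneg hΩ (measurable_gradient d) hV1 hwmc
    (hc.of_isClosed_subset (isClosed_tsupport φ) hφs) (hφs.trans hs) hφ0
  have hpt : ∀ᵐ x ∂(volume.restrict Ω), ⟪gradient d x, gradient φ x⟫ ≤
      ‖gradient u x‖ ^ p - (-F' (d x) - (p - 1) * F (d x) ^ (p / (p - 1))) * v x := by
    filter_upwards [ae_restrict_mem hΩ.measurableSet,
      ae_restrict_of_ae hdlip.ae_differentiableAt] with x hxΩ hxd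
    have h1 := norm_gradient_infDist_compl hΩ hne hxΩ hxd
    rw [real_inner_comm, inner_gradient_left]
    by_cases hx : x ∈ tsupport u
    · have hGder : HasDerivAt G (F' (d x)) (d x) :=
        (hF _ (hdmem x hxΩ)).congr_of_eventuallyEq
          (Filter.eventually_of_mem (hInhds x hx) fun t ht => (hGF ht).symm)
      have hu' : HasFDerivAt u (fderiv ℝ u x) x :=
        (hu.differentiable one_ne_zero x).hasFDerivAt
      have hφ' := (hGder.comp_hasFDerivAt x hxd.hasFDerivAt).mul (hu'.abs_rpow hp)
      have hdd : fderiv ℝ d x (gradient d x) = 1 := by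
        rw [← inner_gradient_left, real_inner_self_eq_norm_sq, h1, one_pow]
      rw [show fderiv ℝ φ x = _ from hφ'.fderiv]
      simp only [add_apply, smul_apply, smul_eq_mul,
        Function.comp, hdd, hGd x hx]
      have hy := young_weighted hp (hF0 _ (hdmem x hxΩ)) (abs_nonneg (u x))
        (norm_nonneg (gradient u x))
      have hle : fderiv ℝ u x (gradient d x) * u x ≤ |u x| * ‖gradient u x‖ := by
        refine (le_abs_self _).trans ?_
        rw [abs_mul, mul_comm, norm_gradient_eq]
        gcongr
        have := (fderiv ℝ u x).le_opNorm (gradient d x)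
        rwa [h1, mul_one] at this
      have hle2 := mul_le_mul_of_nonneg_left hle (mul_nonneg (mul_nonneg hp0.le
        (hF0 _ (hdmem x hxΩ))) (rpow_nonneg (abs_nonneg (u x)) (p - 2)))
      rw [← abs_rpow_sub_two_mul_abs hp] at hy
      simp only [hv]
      linarith
    · rw [fderiv_of_notMem_tsupport ℝ fun h => hx (hφs h), hvzero x hx]
      simp only [zero_apply, mul_zero, sub_zero]
      positivity
  have hdc : ContinuousOn d Ω := hdlip.continuous.continuousOn
  have hFc : ContinuousOn F (Set.Ioo 0 N) := fun t ht => (hF t ht).continuousAt.continuousWithinAt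
  have hWint : IntegrableOn (fun x => (-F' (d x) - (p - 1) * F (d x) ^ (p / (p - 1))) * v x) Ω :=
    (integrable_mul_of_continuousOn hΩ ((hF'.comp hdc hdmem).neg.sub
      (continuousOn_const.mul ((hFc.comp hdc hdmem).rpow_const fun x _ =>
        Or.inr (div_nonneg hp0.le (by linarith))))) hvC.continuous hvc (hvs.trans hs)).integrableOn
  have hgint : IntegrableOn (fun x => ‖gradient u x‖ ^ p) Ω := by
    refine (Continuous.integrable_of_hasCompactSupport ?_ ?_).integrableOn
    · simp_rw [norm_gradient_eq]
      exact (hu.continuous_fderiv one_ne_zero).norm.rpow_const fun _ => Or.inr hp0.le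
    · simp_rw [norm_gradient_eq]
      exact (hc.fderiv (𝕜 := ℝ)).comp_left (g := fun L : E →L[ℝ] ℝ => ‖L‖ ^ p)
        (by simp [zero_rpow hp0.ne'])
  have h := integral_mono_ae hint (hgint.sub hWint) hpt
  simp only [Pi.sub_apply] at h
  rw [integral_sub hgint hWint] at h
  linarith

end Hardy

/-- The partial-sum version of the series improvement. -/
lemma hardy_iterLogSum_le {E : Type*} [NormedAddCommGroup E] [InnerProductSpace ℝ E]
    [FiniteDimensional ℝ E] [MeasurableSpace E] [BorelSpace E]
    {p : ℝ} (hp : 1 < p) {Ω : Set E} (hΩ : IsOpen Ω)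
    (hne : Ωᶜ.Nonempty)
    (hwmc : ∀ φ : E → ℝ, ContDiff ℝ (⊤ : ℕ∞) φ → HasCompactSupport φ → tsupport φ ⊆ Ω →
      (∀ x, 0 ≤ φ x) →
      0 ≤ ∫ x in Ω, ⟪gradient (fun y => Metric.infDist y Ωᶜ) x, gradient φ x⟫)
    {M N : ℝ} (hN : 0 < N) (hMN : M < N) (hM : ∀ x ∈ Ω, Metric.infDist x Ωᶜ ≤ M)
    {u : E → ℝ} (hu : ContDiff ℝ 1 u) (hc : HasCompactSupport u) (hs : tsupport u ⊆ Ω) (K : ℕ) :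
    ((p - 1) / p) ^ p * (∫ x in Ω, |u x| ^ p / Metric.infDist x Ωᶜ ^ p)
          + (p - 1) / (2 * p) * ((p - 1) / p) ^ (p - 2) *
            ∑ k ∈ Finset.range K, ∫ x in Ω, |u x| ^ p / Metric.infDist x Ωᶜ ^ p *
              ∏ j ∈ Finset.Icc 1 (k + 1), iterLog j (Metric.infDist x Ωᶜ / (N * exp 200)) ^ 2
        ≤ ∫ x in Ω, ‖gradient u x‖ ^ p := by
  have hp0 : 0 < p := by linarith
  have hp1 : 0 < p - 1 := by linarith
  set D := N * exp 200 with hDdef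
  have hD : 0 < D := by positivity
  have hlog : ∀ t ∈ Set.Ioo 0 N, 200 ≤ -log (t / D) := by
    intro t ht
    have h1 : t / D ≤ exp (-200) := by
      rw [div_le_iff₀ hD, hDdef, mul_comm N, ← mul_assoc, ← exp_add]
      simpa using ht.2.le
    have h2 := log_le_log (div_pos ht.1 hD) h1
    rw [log_exp] at h2
    linarith
  have hmem : ∀ t ∈ Set.Ioo 0 N, t / D ∈ Set.Ioo (0 : ℝ) 1 := by
    intro t ht
    have h := hlog t ht
    have h0 := div_pos ht.1 hD
    refine ⟨h0, ?_⟩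
    by_contra! h1
    linarith [log_nonneg h1]
  set h : ℝ := (p - 1) / p with hh
  have hh0 : 0 < h := by positivity
  set e : ℝ → ℝ := fun t => iterLogSum 1 K (t / D) with he
  set S : ℝ → ℝ := fun t => iterLogSum 2 K (t / D) with hS
  have he0 : ∀ t ∈ Set.Ioo 0 N, 0 ≤ e t := fun t ht => iterLogSum_nonneg 1 K (hmem t ht)
  have he1 : ∀ t ∈ Set.Ioo 0 N, e t ≤ 1 / 100 := by
    intro t ht
    refine (iterLogSum_one_le K (hmem t ht)).trans ?_
    have := hlog t ht
    rw [div_le_iff₀ (by linarith)]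
    linarith
  have heS : ∀ t ∈ Set.Ioo 0 N, e t ^ 2 ≤ 9 * S t := fun t ht =>
    iterLogSum_one_sq_le K (hmem t ht) (by linarith [hlog t ht])
  have hg1 : ∀ t ∈ Set.Ioo 0 N, 0 < 1 - (e t + 9 * e t ^ 2) := by
    intro t ht
    nlinarith [he0 t ht, he1 t ht]
  have hed : ∀ t ∈ Set.Ioo 0 N, HasDerivAt e ((e t ^ 2 + S t) / 2 / t) t := by
    intro t ht
    refine ((hasDerivAt_iterLogSum_one K (hmem t ht)).comp t
      ((hasDerivAt_id t).div_const D)).congr_deriv ?_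
    have := ht.1.ne'
    simp only [he, hS]
    field_simp
  set F : ℝ → ℝ := fun t => h ^ (p - 1) * t ^ (1 - p) * (1 - (e t + 9 * e t ^ 2)) with hF
  set F' : ℝ → ℝ := fun t => -(h ^ (p - 1) * t ^ (-p) * ((p - 1) * (1 - (e t + 9 * e t ^ 2)) +
    (1 + 18 * e t) * ((e t ^ 2 + S t) / 2))) with hF'
  have hSc : ContinuousOn S (Set.Ioo 0 N) := fun t ht =>
    (ContinuousAt.comp (f := fun t => t / D) (continuousAt_iterLogSum 2 K (hmem t ht))
      (continuousAt_id.div_const D)).continuousWithinAt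
  have hec : ContinuousOn e (Set.Ioo 0 N) := fun t ht =>
    (hed t ht).continuousAt.continuousWithinAt
  have hFd : ∀ t ∈ Set.Ioo 0 N, HasDerivAt F (F' t) t := by
    intro t ht
    have hx := (((hasDerivAt_id t).rpow_const (p := 1 - p) (Or.inl ht.1.ne')).const_mul
      (h ^ (p - 1))).mul (((hed t ht).add (((hed t ht).pow 2).const_mul 9)).const_sub 1)
    refine hx.congr_deriv ?_
    have ht0 := ht.1.ne'
    have hpow : t ^ (1 - p) = t ^ (-p) * t := by
      rw [← rpow_add_one ht0]; congr 1; ring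
    have hpow2 : t ^ (1 - p - 1) = t ^ (-p) := by congr 1; ring
    simp only [hF', id, hpow, hpow2, Pi.add_apply, Pi.pow_apply]
    field_simp
    ring
  have hF'c : ContinuousOn F' (Set.Ioo 0 N) := by
    have hr : ContinuousOn (fun t : ℝ => t ^ (-p)) (Set.Ioo 0 N) :=
      continuousOn_id.rpow_const fun t ht => Or.inl ht.1.ne'
    fun_prop
  have hF0 : ∀ t ∈ Set.Ioo 0 N, 0 ≤ F t := fun t ht => by
    have := hg1 t ht
    have := ht.1
    positivity
  have hmain := integral_hardy_potential_le hp hΩ hne hwmc hMN hM hFd hF'c hF0 hu hc hs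
  refine le_trans ?_ hmain
  have hdmem : ∀ x ∈ Ω, Metric.infDist x Ωᶜ ∈ Set.Ioo 0 N := fun x hx =>
    ⟨(hΩ.isClosed_compl.notMem_iff_infDist_pos hne).1 (fun h => h hx), (hM x hx).trans_lt hMN⟩
  have hdc : ContinuousOn (fun x => Metric.infDist x Ωᶜ) Ω :=
    (Metric.continuous_infDist_pt _).continuousOn
  have hvC : Continuous (fun x => |u x| ^ p) := (hu.norm_rpow hp).continuous
  have hvc : HasCompactSupport (fun x => |u x| ^ p) :=
    hc.comp_left (g := fun a : ℝ => |a| ^ p) (by simp [zero_rpow hp0.ne'])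
  have hvs : tsupport (fun x => |u x| ^ p) ⊆ Ω := by
    refine (closure_mono (Function.support_subset_iff'.2 fun x hx => ?_)).trans hs
    simp [Function.notMem_support.1 hx, zero_rpow hp0.ne']
  have hdp : ContinuousOn (fun x => (Metric.infDist x Ωᶜ ^ p)⁻¹) Ω :=
    (hdc.rpow_const fun _ _ => Or.inr hp0.le).inv₀ fun x hx =>
      (rpow_pos_of_pos (hdmem x hx).1 p).ne'
  have hcomp : ∀ {G : ℝ → ℝ}, (∀ s ∈ Set.Ioo (0 : ℝ) 1, ContinuousAt G s) →
      ContinuousOn (fun x => G (Metric.infDist x Ωᶜ / D)) Ω := fun {G} hG x hx =>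
    ContinuousAt.comp_continuousWithinAt (f := fun x => Metric.infDist x Ωᶜ / D)
      (hG _ (hmem _ (hdmem x hx))) ((hdc x hx).div_const D)
  have hint0 : IntegrableOn (fun x => |u x| ^ p / Metric.infDist x Ωᶜ ^ p) Ω :=
    (integrable_mul_of_continuousOn hΩ hdp hvC hvc hvs).integrableOn.congr_fun
      (fun x _ => by simp only; rw [div_eq_mul_inv, mul_comm]) hΩ.measurableSet
  have hintk : ∀ k ∈ Finset.range K, IntegrableOn (fun x => |u x| ^ p / Metric.infDist x Ωᶜ ^ p *
      ∏ j ∈ Finset.Icc 1 (k + 1), iterLog j (Metric.infDist x Ωᶜ / D) ^ 2) Ω := fun k _ =>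
    (integrable_mul_of_continuousOn hΩ (hdp.mul (hcomp fun s hs =>
      continuousAt_prod_iterLog 2 (k + 1) hs)) hvC hvc hvs).integrableOn.congr_fun
      (fun x _ => by simp only [Pi.mul_apply]; ring) hΩ.measurableSet
  have hWint : IntegrableOn (fun x => (-F' (Metric.infDist x Ωᶜ) -
      (p - 1) * F (Metric.infDist x Ωᶜ) ^ (p / (p - 1))) * |u x| ^ p) Ω := by
    have hFc : ContinuousOn F (Set.Ioo 0 N) := fun t ht =>
      (hFd t ht).continuousAt.continuousWithinAt
    exact (integrable_mul_of_continuousOn hΩ ((hF'c.comp hdc hdmem).neg.sub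
      (continuousOn_const.mul ((hFc.comp hdc hdmem).rpow_const fun x _ =>
        Or.inr (div_nonneg hp0.le hp1.le)))) hvC hvc hvs).integrableOn
  rw [← integral_finsetSum _ hintk, ← integral_const_mul, ← integral_const_mul,
    ← integral_add (hint0.const_mul _) ((integrable_finsetSum _ hintk).const_mul _)]
  refine setIntegral_mono_on ((hint0.const_mul _).add
    ((integrable_finsetSum _ hintk).const_mul _)) hWint hΩ.measurableSet fun x hx => ?_
  have hxN := hdmem x hx
  rw [← Finset.mul_sum, ← iterLogSum]
  generalize Metric.infDist x Ωᶜ = t at hxN ⊢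
  change h ^ p * (|u x| ^ p / t ^ p) + (p - 1) / (2 * p) * h ^ (p - 2) *
    (|u x| ^ p / t ^ p * S t) ≤ _
  have hk := hardy_potential_ge hp (he0 t hxN) (he1 t hxN) (heS t hxN)
  have ht := hxN.1
  have hcoef : (p - 1) / (2 * p) * h ^ (p - 2) = h ^ (p - 1) / 2 := by
    have : h ^ (p - 1) = h ^ (p - 2) * h := by
      rw [← rpow_add_one hh0.ne']; congr 1; ring
    rw [this, hh]; field_simp
  have hhp : h ^ p = h ^ (p - 1) * h := by
    rw [← rpow_add_one hh0.ne']; congr 1; ring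
  have hFq : F t ^ (p / (p - 1)) = h ^ (p - 1) * h * t ^ (-p) *
      (1 - (e t + 9 * e t ^ 2)) ^ (p / (p - 1)) := by
    have hg := hg1 t hxN
    rw [← hhp, hF]
    simp only
    rw [mul_rpow (by positivity) hg.le, mul_rpow (by positivity) (by positivity),
      ← rpow_mul hh0.le, ← rpow_mul ht.le]
    congr 3
    · field_simp
    · field_simp; ring
  rw [hcoef, hFq, hhp, div_eq_mul_inv, ← rpow_neg ht.le]
  have hfin := mul_le_mul_of_nonneg_left hk
    (show 0 ≤ h ^ (p - 1) * t ^ (-p) * |u x| ^ p by positivity)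
  simp only [hF']
  rw [← hh] at hfin
  linarith

/-- **Series improvement of the Hardy inequality for weakly mean convex domains.**
If `p > 1` and `Ω ⊊ ℝⁿ` is a nonempty open connected weakly mean convex set with
`sup_Ω d < ∞`, then there exists `D ≥ sup_Ω d` such that for all `u ∈ C_c^∞(Ω)`:
`∫_Ω ‖∇u‖^p ≥ ((p-1)/p)^p ∫_Ω |u|^p/d^p
  + ((p-1)/(2p)) ((p-1)/p)^{p-2} Σ_{k=1}^∞ ∫_Ω (|u|^p/d^p) X₁²X₂²⋯X_k²`,
where `X_j = X_j(d(x)/D)`. -/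
theorem hardy_series_improvement_weakly_mean_convex
    (p : ℝ) (hp : 1 < p) (n : ℕ)
    (Ω : Set (EuclideanSpace ℝ (Fin n)))
    (hopen : IsOpen Ω) (hne : Ω.Nonempty) (hproper : Ω ≠ Set.univ)
    (hconn : IsConnected Ω)
    (hwmc : ∀ φ : EuclideanSpace ℝ (Fin n) → ℝ,
      ContDiff ℝ (⊤ : ℕ∞) φ → HasCompactSupport φ → tsupport φ ⊆ Ω → (∀ x, 0 ≤ φ x) →
      0 ≤ ∫ x in Ω, ⟪gradient (fun y => Metric.infDist y Ωᶜ) x, gradient φ x⟫)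
    (hbdd : ∃ M : ℝ, ∀ x ∈ Ω, Metric.infDist x Ωᶜ ≤ M) :
    ∃ D : ℝ, (∀ x ∈ Ω, Metric.infDist x Ωᶜ ≤ D) ∧
      ∀ u : EuclideanSpace ℝ (Fin n) → ℝ,
        ContDiff ℝ (⊤ : ℕ∞) u → HasCompactSupport u → tsupport u ⊆ Ω →
        ((p - 1) / p) ^ p * (∫ x in Ω, |u x| ^ p / Metric.infDist x Ωᶜ ^ p)
          + (p - 1) / (2 * p) * ((p - 1) / p) ^ (p - 2) *
            ∑' k : ℕ, ∫ x in Ω, |u x| ^ p / Metric.infDist x Ωᶜ ^ p *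
              ∏ j ∈ Finset.Icc 1 (k + 1), iterLog j (Metric.infDist x Ωᶜ / D) ^ 2
        ≤ ∫ x in Ω, ‖gradient u x‖ ^ p := by
  obtain ⟨M, hM⟩ := hbdd
  have hM' : M < |M| + 1 := (le_abs_self M).trans_lt (lt_add_one _)
  have hN : 0 < |M| + 1 := by positivity
  have hc : Ωᶜ.Nonempty := Set.nonempty_compl.2 hproper
  refine ⟨(|M| + 1) * exp 200, fun x hx => (hM x hx).trans (hM'.le.trans ?_), fun u hu hcs hs => ?_⟩
  · exact le_mul_of_one_le_right hN.le (one_le_exp (by norm_num))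
  set D := (|M| + 1) * exp 200 with hD
  set a : ℕ → ℝ := fun k => ∫ x in Ω, |u x| ^ p / Metric.infDist x Ωᶜ ^ p *
    ∏ j ∈ Finset.Icc 1 (k + 1), iterLog j (Metric.infDist x Ωᶜ / D) ^ 2 with ha
  have h0 : 0 < (p - 1) / (2 * p) * ((p - 1) / p) ^ (p - 2) := by
    have : 0 < p - 1 := by linarith
    positivity
  have hsum : ∑' k, a k ≤ ((∫ x in Ω, ‖gradient u x‖ ^ p) -
      ((p - 1) / p) ^ p * ∫ x in Ω, |u x| ^ p / Metric.infDist x Ωᶜ ^ p) /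
      ((p - 1) / (2 * p) * ((p - 1) / p) ^ (p - 2)) := by
    refine Real.tsum_le_of_sum_range_le (fun k => integral_nonneg fun x => ?_) fun K => ?_
    · have : 0 ≤ Metric.infDist x Ωᶜ := Metric.infDist_nonneg
      exact mul_nonneg (by positivity) (Finset.prod_nonneg fun j _ => sq_nonneg _)
    · rw [le_div_iff₀ h0, mul_comm]
      have := hardy_iterLogSum_le hp hopen hc hwmc hN hM' hM (hu.of_le (by norm_cast)) hcs hs K
      linarith
  rw [le_div_iff₀ h0, mul_comm] at hsum
  linarith
end

section
/- Let n ≥ 3 and 0 < r < R < ∞, and let Ω = {x ∈ ℝⁿ : r < |x| < R} be the annulus. Then H(Ω) = 1/4; that is, ∫_Ω ‖∇u‖² dx ≥ (1/4) ∫_Ω u²/d² dx for every u ∈ C_c^∞(Ω), and 1/4 is the largest constant for which this inequality holds for all u ∈ C_c^∞(Ω). -/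
open MeasureTheory Real

theorem integral_fderiv_self_add_dim_mul_eq_zero {n : ℕ} {A : EuclideanSpace ℝ (Fin n) → ℝ}
    (hA : ContDiff ℝ 1 A) (hc : HasCompactSupport A) :
    ∫ x, (fderiv ℝ A x x + n * A x) = 0 := by
  have hd : Differentiable ℝ A := hA.differentiable one_ne_zero
  have hcf : Continuous (fderiv ℝ A) := hA.continuous_fderiv one_ne_zero
  have hcs : HasCompactSupport (fderiv ℝ A) := hc.fderiv ℝ
  have hAi : Integrable A := hA.continuous.integrable_of_hasCompactSupport hc
  have hprod (i : Fin n) :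
      Integrable (fun x : EuclideanSpace ℝ (Fin n) ↦
        x i * fderiv ℝ A x (EuclideanSpace.single i 1)) := by
    refine Continuous.integrable_of_hasCompactSupport (by fun_prop) ?_
    refine hcs.mono fun x hx hx' ↦ hx ?_
    simp [hx']
  have hcoord (i : Fin n) :
      ∫ x : EuclideanSpace ℝ (Fin n), x i * fderiv ℝ A x (EuclideanSpace.single i 1)
        = -∫ x, A x := by
    have hf (x : EuclideanSpace ℝ (Fin n)) :
        fderiv ℝ (fun x : EuclideanSpace ℝ (Fin n) ↦ x i) x (EuclideanSpace.single i 1) = 1 := by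
      have := (EuclideanSpace.proj i : EuclideanSpace ℝ (Fin n) →L[ℝ] ℝ).fderiv (x := x)
      have h2 := DFunLike.congr_fun this (EuclideanSpace.single i (1 : ℝ))
      simpa using h2
    rw [integral_mul_fderiv_eq_neg_fderiv_mul_of_integrable]
    · simp [hf]
    · simpa [hf] using hAi
    · exact hprod i
    · refine Continuous.integrable_of_hasCompactSupport (by fun_prop) ?_
      exact hc.mul_left
    · exact fun x _ ↦ by fun_prop
    · exact fun x _ ↦ hd x
  have hsum (x : EuclideanSpace ℝ (Fin n)) :
      fderiv ℝ A x x = ∑ i, x i * fderiv ℝ A x (EuclideanSpace.single i 1) := by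
    conv_lhs => rw [← (EuclideanSpace.basisFun (Fin n) ℝ).sum_repr x]
    rw [map_sum (fderiv ℝ A _)]
    have : ∑ i, ((EuclideanSpace.basisFun (Fin n) ℝ).repr x).ofLp i •
      (EuclideanSpace.basisFun (Fin n) ℝ) i = x := (EuclideanSpace.basisFun (Fin n) ℝ).sum_repr x
    simp only [this]
    simp
  simp_rw [hsum]
  rw [integral_add (integrable_finsetSum _ fun i _ ↦ hprod i) (hAi.const_mul _),
    integral_finsetSum _ fun i _ ↦ hprod i, integral_const_mul]
  simp [hcoord]

theorem norm_gradient_eq_norm_fderiv {n : ℕ} (u : EuclideanSpace ℝ (Fin n) → ℝ)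
    (x : EuclideanSpace ℝ (Fin n)) : ‖gradient u x‖ = ‖fderiv ℝ u x‖ := by
  simp [gradient]

theorem min_le_infDist_compl_annulus {n : ℕ} {r R : ℝ} (hr : 0 < r)
    {x : EuclideanSpace ℝ (Fin n)} :
    min (‖x‖ - r) (R - ‖x‖) ≤
      Metric.infDist x {x : EuclideanSpace ℝ (Fin n) | r < ‖x‖ ∧ ‖x‖ < R}ᶜ := by
  refine (Metric.le_infDist ⟨0, by simp [not_lt.2 hr.le]⟩).2 fun y hy ↦ ?_
  have h := abs_norm_sub_norm_le x y
  rw [← dist_eq_norm, abs_le] at h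
  simp only [Set.mem_compl_iff, Set.mem_ofPred_eq, not_and, not_lt] at hy
  by_cases hry : r < ‖y‖
  · exact (min_le_right _ _).trans (by linarith [hy hry])
  · exact (min_le_left _ _).trans (by linarith)

/-- The radial profile of the vector field `x ↦ hardyProfile n r R ‖x‖ • x`. -/
noncomputable def hardyProfile (n : ℕ) (r R y : ℝ) : ℝ :=
  (-1 / 2 * (y - r)⁻¹ + 1 / 2 * (R - y)⁻¹ + (n - 1) / 2 * y⁻¹) * y⁻¹

theorem hasDerivAt_hardyProfile (n : ℕ) {r R y : ℝ} (hr : 0 < r) (h1 : r < y) (h2 : y < R) :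
    HasDerivAt (hardyProfile n r R)
      ((1 / 2 * (y - r)⁻¹ ^ 2 + 1 / 2 * (R - y)⁻¹ ^ 2 - (n - 1) / 2 * y⁻¹ ^ 2) * y⁻¹
        - (-1 / 2 * (y - r)⁻¹ + 1 / 2 * (R - y)⁻¹ + (n - 1) / 2 * y⁻¹) * y⁻¹ ^ 2) y := by
  have a : HasDerivAt (fun y ↦ (y - r)⁻¹) (-1 / (y - r) ^ 2) y :=
    ((hasDerivAt_id y).sub_const r).inv (sub_pos.2 h1).ne'
  have b : HasDerivAt (fun y ↦ (R - y)⁻¹) (-(-1) / (R - y) ^ 2) y :=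
    ((hasDerivAt_id y).const_sub R).inv (sub_pos.2 h2).ne'
  have c := hasDerivAt_inv (hr.trans h1).ne'
  refine ((((a.const_mul (-1 / 2)).add (b.const_mul (1 / 2))).add
    (c.const_mul ((n - 1 : ℝ) / 2))).mul c).congr_deriv ?_
  simp only [Pi.add_apply, div_eq_mul_inv, ← inv_pow]
  ring

theorem hardyProfile_riccati {n : ℕ} (hn : 3 ≤ n) {r R y : ℝ} (hr : 0 < r) (h1 : r < y)
    (h2 : y < R) :
    1 / (4 * min (y - r) (R - y) ^ 2) ≤
      y * deriv (hardyProfile n r R) y + n * hardyProfile n r R y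
        - hardyProfile n r R y ^ 2 * y ^ 2 := by
  have hy : y ≠ 0 := (hr.trans h1).ne'
  have ha : 0 < (y - r)⁻¹ := inv_pos.2 (sub_pos.2 h1)
  have hb : 0 < (R - y)⁻¹ := inv_pos.2 (sub_pos.2 h2)
  have hn' : (3 : ℝ) ≤ n := by exact_mod_cast hn
  have key : y * deriv (hardyProfile n r R) y + n * hardyProfile n r R y
        - hardyProfile n r R y ^ 2 * y ^ 2 =
      1 / 4 * ((y - r)⁻¹ + (R - y)⁻¹) ^ 2 + (n - 1) * (n - 3) / 4 * y⁻¹ ^ 2 := by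
    rw [(hasDerivAt_hardyProfile n hr h1 h2).deriv, hardyProfile]
    generalize (y - r)⁻¹ = a
    generalize (R - y)⁻¹ = b
    field_simp
    ring
  rw [key]
  have h3 : 0 ≤ ((n : ℝ) - 1) * (n - 3) / 4 * y⁻¹ ^ 2 := by
    have : 0 ≤ ((n : ℝ) - 1) * (n - 3) := mul_nonneg (by linarith) (by linarith)
    positivity
  have h4 : 1 / (4 * min (y - r) (R - y) ^ 2) = 1 / 4 * (min (y - r) (R - y))⁻¹ ^ 2 := by
    rw [one_div, mul_inv, inv_pow]; norm_num
  rw [h4]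
  rcases min_choice (y - r) (R - y) with h | h <;> rw [h] <;> nlinarith

theorem hardy_inequality_annulus
    {n : ℕ} (hn : 3 ≤ n) {r R : ℝ} (hr : 0 < r)
    {u : EuclideanSpace ℝ (Fin n) → ℝ} (hu : ContDiff ℝ (⊤ : ℕ∞) u) (hc : HasCompactSupport u)
    (hs : tsupport u ⊆ {x : EuclideanSpace ℝ (Fin n) | r < ‖x‖ ∧ ‖x‖ < R}) :
    (1 / 4 : ℝ) * ∫ x in {x : EuclideanSpace ℝ (Fin n) | r < ‖x‖ ∧ ‖x‖ < R},
        u x ^ 2 / Metric.infDist x {x : EuclideanSpace ℝ (Fin n) | r < ‖x‖ ∧ ‖x‖ < R}ᶜ ^ 2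
      ≤ ∫ x in {x : EuclideanSpace ℝ (Fin n) | r < ‖x‖ ∧ ‖x‖ < R}, ‖gradient u x‖ ^ 2 := by
  set Ω := {x : EuclideanSpace ℝ (Fin n) | r < ‖x‖ ∧ ‖x‖ < R}
  have hn0 : NeZero n := ⟨by lia⟩
  set A : EuclideanSpace ℝ (Fin n) → ℝ := fun x ↦ u x ^ 2 * hardyProfile n r R ‖x‖ with hAdef
  have hu0 : ∀ x ∉ Ω, u x = 0 := fun x hx ↦ image_eq_zero_of_notMem_tsupport fun h ↦ hx (hs h)
  have hdu0 : ∀ x ∉ Ω, fderiv ℝ u x = 0 := fun x hx ↦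
    fderiv_of_notMem_tsupport ℝ fun h ↦ hx (hs h)
  have hAs : Function.support A ⊆ Function.support u := fun x hx hx' ↦ hx (by simp [hAdef, hx'])
  have hAc : HasCompactSupport A := hc.mono hAs
  have hA : ContDiff ℝ 1 A := by
    refine contDiff_iff_contDiffAt.2 fun x ↦ ?_
    by_cases hx : x ∈ tsupport u
    · obtain ⟨h1, h2⟩ := hs hx
      have hx0 : x ≠ 0 := norm_pos_iff.1 (hr.trans h1)
      have hN : ContDiffAt ℝ 1 (fun x : EuclideanSpace ℝ (Fin n) ↦ ‖x‖) x := contDiffAt_norm ℝ hx0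
      have hP : ContDiffAt ℝ 1 (hardyProfile n r R) ‖x‖ := by
        unfold hardyProfile
        have := (sub_pos.2 h1).ne'
        have := (sub_pos.2 h2).ne'
        have := (hr.trans h1).ne'
        fun_prop (disch := assumption)
      exact ((hu.contDiffAt.of_le (by exact_mod_cast le_top)).pow 2).mul (hP.comp x hN)
    · have h0 : A =ᶠ[nhds x] fun _ ↦ 0 := by
        filter_upwards [notMem_tsupport_iff_eventuallyEq.1 hx] with y hy
        simp [hAdef, hy]
      exact contDiffAt_const.congr_of_eventuallyEq h0
  have hdiv := integral_fderiv_self_add_dim_mul_eq_zero hA hAc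
  have hdu : Continuous (fderiv ℝ u) := hu.continuous_fderiv (by simp)
  have hgi : Integrable fun x ↦ ‖fderiv ℝ u x‖ ^ 2 := by
    refine Continuous.integrable_of_hasCompactSupport (by fun_prop) ?_
    exact (hc.fderiv ℝ).mono fun x hx hx' ↦ hx (by simp [hx'])
  have hdi : Integrable fun x ↦ fderiv ℝ A x x + n * A x := by
    have := hA.continuous_fderiv one_ne_zero
    refine Continuous.integrable_of_hasCompactSupport (by fun_prop) ?_
    refine HasCompactSupport.add ?_ hAc.mul_left
    exact (hAc.fderiv ℝ).mono fun x hx hx' ↦ hx (by simp [hx'])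
  have hptw : ∀ x, 1 / 4 * (u x ^ 2 / Metric.infDist x Ωᶜ ^ 2) ≤
      ‖fderiv ℝ u x‖ ^ 2 + (fderiv ℝ A x x + n * A x) := by
    intro x
    by_cases hx : x ∈ tsupport u
    swap
    · have h1 : u x = 0 := image_eq_zero_of_notMem_tsupport hx
      have h2 : fderiv ℝ A x = 0 :=
        fderiv_of_notMem_tsupport ℝ fun h ↦ hx (closure_mono hAs h)
      rw [h2]
      simp [h1, hAdef]
    obtain ⟨h1, h2⟩ := hs hx
    have hx0 : x ≠ 0 := norm_pos_iff.1 (hr.trans h1)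
    have hρ : 0 < ‖x‖ := hr.trans h1
    have hN : DifferentiableAt ℝ (fun x : EuclideanSpace ℝ (Fin n) ↦ ‖x‖) x :=
      (contDiffAt_norm ℝ hx0).differentiableAt one_ne_zero
    have hP := (hasDerivAt_hardyProfile n hr h1 h2).differentiableAt.hasDerivAt
    have hU : HasFDerivAt u (fderiv ℝ u x) x := (hu.differentiable (by simp) x).hasFDerivAt
    have hDA : fderiv ℝ A x x = 2 * u x * fderiv ℝ u x x * hardyProfile n r R ‖x‖ +
        u x ^ 2 * (‖x‖ * deriv (hardyProfile n r R) ‖x‖) := by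
      have := ((hU.pow 2).mul (hP.comp_hasFDerivAt x hN.hasFDerivAt)).fderiv
      have h3 := DFunLike.congr_fun this x
      refine h3.trans ?_
      simp [hN.fderiv_norm_self]
      ring
    have hop : fderiv ℝ u x x ^ 2 ≤ ‖fderiv ℝ u x‖ ^ 2 * ‖x‖ ^ 2 := by
      rw [← mul_pow, ← sq_abs]
      have := (fderiv ℝ u x).le_opNorm x
      rw [Real.norm_eq_abs] at this
      gcongr
    have hop' : (fderiv ℝ u x x / ‖x‖) ^ 2 ≤ ‖fderiv ℝ u x‖ ^ 2 := by
      rw [div_pow, div_le_iff₀ (by positivity)]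
      exact hop
    have hric := hardyProfile_riccati hn hr h1 h2
    have hm : 0 < min (‖x‖ - r) (R - ‖x‖) := lt_min (sub_pos.2 h1) (sub_pos.2 h2)
    have hdist : 1 / 4 * (u x ^ 2 / Metric.infDist x Ωᶜ ^ 2) ≤
        u x ^ 2 * (1 / (4 * min (‖x‖ - r) (R - ‖x‖) ^ 2)) := by
      have : 1 / 4 * (u x ^ 2 / Metric.infDist x Ωᶜ ^ 2) =
        u x ^ 2 * (1 / (4 * Metric.infDist x Ωᶜ ^ 2)) := by
        rw [mul_one_div, mul_comm 4, ← div_div]; ring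
      rw [this]
      gcongr
      exact min_le_infDist_compl_annulus hr
    have hmul := mul_le_mul_of_nonneg_left hric (sq_nonneg (u x))
    have hsq := sq_nonneg (fderiv ℝ u x x / ‖x‖ + u x * hardyProfile n r R ‖x‖ * ‖x‖)
    have hexp : (fderiv ℝ u x x / ‖x‖ + u x * hardyProfile n r R ‖x‖ * ‖x‖) ^ 2 =
        (fderiv ℝ u x x / ‖x‖) ^ 2 + 2 * u x * fderiv ℝ u x x * hardyProfile n r R ‖x‖
          + u x ^ 2 * hardyProfile n r R ‖x‖ ^ 2 * ‖x‖ ^ 2 := by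
      field_simp
      ring
    rw [hDA]
    simp only [hAdef]
    nlinarith
  rw [setIntegral_eq_integral_of_forall_compl_eq_zero fun x hx ↦ by simp [hu0 x hx],
    setIntegral_eq_integral_of_forall_compl_eq_zero fun x hx ↦ by
      simp [norm_gradient_eq_norm_fderiv, hdu0 x hx], ← integral_const_mul]
  simp_rw [norm_gradient_eq_norm_fderiv]
  calc _ ≤ ∫ x, (‖fderiv ℝ u x‖ ^ 2 + (fderiv ℝ A x x + n * A x)) :=
        integral_mono_of_nonneg (.of_forall fun x ↦ by positivity) (hgi.add hdi) (.of_forall hptw)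
    _ = _ := by rw [integral_add hgi hdi, hdiv, add_zero]

theorem infDist_compl_annulus_eq {n : ℕ} {r R : ℝ} (hr : 0 < r)
    {x : EuclideanSpace ℝ (Fin n)} (h1 : r < ‖x‖) (h2 : ‖x‖ - r ≤ R - ‖x‖) :
    Metric.infDist x {x : EuclideanSpace ℝ (Fin n) | r < ‖x‖ ∧ ‖x‖ < R}ᶜ = ‖x‖ - r := by
  have hρ : 0 < ‖x‖ := hr.trans h1
  refine le_antisymm ?_ ?_
  · have hy : (r / ‖x‖) • x ∈ {x : EuclideanSpace ℝ (Fin n) | r < ‖x‖ ∧ ‖x‖ < R}ᶜ := by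
      have : ‖(r / ‖x‖) • x‖ = r := by
        rw [norm_smul, Real.norm_of_nonneg (by positivity)]
        field_simp
      simp [this]
    refine (Metric.infDist_le_dist_of_mem hy).trans_eq ?_
    have h3 : x - (r / ‖x‖) • x = (1 - r / ‖x‖) • x := by rw [sub_smul, one_smul]
    have h4 : 0 ≤ 1 - r / ‖x‖ := by
      rw [sub_nonneg, div_le_one hρ]
      exact h1.le
    rw [dist_eq_norm, h3, norm_smul, Real.norm_of_nonneg h4]
    field_simp
  · have h := min_le_infDist_compl_annulus (R := R) hr (x := x)
    rwa [min_eq_left h2] at h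

theorem setIntegral_annulus_comp_norm {n : ℕ} (hn : 3 ≤ n) {r R : ℝ} (hr : 0 < r) (hrR : r < R)
    (H : ℝ → ℝ) :
    ∫ x in {x : EuclideanSpace ℝ (Fin n) | r < ‖x‖ ∧ ‖x‖ < R}, H ‖x‖ =
      n * volume.real (Metric.ball (0 : EuclideanSpace ℝ (Fin n)) 1) *
        ∫ s in Set.Iio (log (R - r)), (r + exp s) ^ (n - 1) * (exp s * H (r + exp s)) := by
  have hn0 : NeZero n := ⟨by lia⟩
  have hmeas : MeasurableSet {x : EuclideanSpace ℝ (Fin n) | r < ‖x‖ ∧ ‖x‖ < R} :=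
    ((isOpen_lt continuous_const continuous_norm).inter
      (isOpen_lt continuous_norm continuous_const)).measurableSet
  have himg : (fun s ↦ r + exp s) '' Set.Iio (log (R - r)) = Set.Ioo r R := by
    ext y
    constructor
    · rintro ⟨s, hs, rfl⟩
      have := (lt_log_iff_exp_lt (sub_pos.2 hrR)).1 hs
      exact ⟨by linarith [exp_pos s], by linarith⟩
    · rintro ⟨h1, h2⟩
      refine ⟨log (y - r), log_lt_log (sub_pos.2 h1) (by linarith), ?_⟩
      simp [exp_log (sub_pos.2 h1)]
  have hind (x : EuclideanSpace ℝ (Fin n)) :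
      Set.indicator {x : EuclideanSpace ℝ (Fin n) | r < ‖x‖ ∧ ‖x‖ < R} (fun x ↦ H ‖x‖) x =
        (Set.Ioo r R).indicator H ‖x‖ := by
    simp only [Set.indicator, Set.mem_Ioo, Set.mem_ofPred_eq]
  have hind' (y : ℝ) : y ^ (n - 1) • (Set.Ioo r R).indicator H y =
      (Set.Ioo r R).indicator (fun y ↦ y ^ (n - 1) * H y) y := by
    by_cases hy : y ∈ Set.Ioo r R <;> simp [hy]
  rw [← integral_indicator hmeas]
  simp_rw [hind]
  rw [integral_fun_norm_addHaar volume, finrank_euclideanSpace_fin]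
  simp_rw [hind']
  rw [setIntegral_indicator measurableSet_Ioo,
    Set.inter_eq_self_of_subset_right (Set.Ioo_subset_Ioi_self.trans (Set.Ioi_subset_Ioi hr.le)),
    ← himg, integral_image_eq_integral_abs_deriv_smul measurableSet_Iio (f' := exp)
      (fun s _ ↦ ((hasDerivAt_exp s).const_add r).hasDerivWithinAt)
      (fun s _ t _ hst ↦ exp_injective (add_left_cancel hst))]
  simp only [abs_exp, smul_eq_mul, nsmul_eq_mul]
  rw [mul_assoc]
  congr 2
  refine integral_congr_ae (.of_forall fun s ↦ ?_)
  ring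

/-- `HasHardyConstant Ω c` says that the Hardy inequality with constant `c` holds on `Ω`. -/
def HasHardyConstant {n : ℕ} (Ω : Set (EuclideanSpace ℝ (Fin n))) (c : ℝ) : Prop :=
  ∀ u : EuclideanSpace ℝ (Fin n) → ℝ,
    ContDiff ℝ (⊤ : ℕ∞) u → HasCompactSupport u → tsupport u ⊆ Ω →
    c * ∫ x in Ω, u x ^ 2 / Metric.infDist x Ωᶜ ^ 2 ≤ ∫ x in Ω, ‖gradient u x‖ ^ 2

theorem HasHardyConstant.weighted_log_inequality {n : ℕ} (hn : 3 ≤ n) {r R : ℝ} (hr : 0 < r)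
    (hrR : r < R) {c : ℝ}
    (H : HasHardyConstant {x : EuclideanSpace ℝ (Fin n) | r < ‖x‖ ∧ ‖x‖ < R} c)
    {η : ℝ → ℝ} (hη : ContDiff ℝ (⊤ : ℕ∞) η) {a b : ℝ} (hs : Function.support η ⊆ Set.Icc a b)
    (hb : 2 * exp b ≤ R - r) :
    c * ∫ s, (r + exp s) ^ (n - 1) * η s ^ 2 ≤
      ∫ s, (r + exp s) ^ (n - 1) * (η s / 2 + deriv η s) ^ 2 := by
  have hn0 : NeZero n := ⟨by lia⟩
  set ψ : ℝ → ℝ := fun y ↦ √(y - r) * η (log (y - r)) with hψ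
  set K := {x : EuclideanSpace ℝ (Fin n) | r + exp a ≤ ‖x‖ ∧ ‖x‖ ≤ r + exp b}
  have hKc : IsClosed K := (isClosed_le continuous_const continuous_norm).inter
    (isClosed_le continuous_norm continuous_const)
  have hsupp : Function.support (fun x : EuclideanSpace ℝ (Fin n) ↦ ψ ‖x‖) ⊆ K := by
    intro x hx
    have h1 : 0 < ‖x‖ - r := by
      by_contra! h
      exact hx (by simp [hψ, sqrt_eq_zero_of_nonpos h])
    have h2 : η (log (‖x‖ - r)) ≠ 0 := fun h ↦ hx (by simp [hψ, h])
    obtain ⟨h3, h4⟩ := hs h2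
    rw [le_log_iff_exp_le h1] at h3
    rw [log_le_iff_le_exp h1] at h4
    exact ⟨by linarith, by linarith⟩
  have hts : tsupport (fun x : EuclideanSpace ℝ (Fin n) ↦ ψ ‖x‖) ⊆ K := closure_minimal hsupp hKc
  have hKΩ : K ⊆ {x : EuclideanSpace ℝ (Fin n) | r < ‖x‖ ∧ ‖x‖ < R} := fun x hx ↦
    ⟨by linarith [hx.1, exp_pos a], by linarith [hx.2, exp_pos b]⟩
  have hcs : HasCompactSupport (fun x : EuclideanSpace ℝ (Fin n) ↦ ψ ‖x‖) := by
    refine .of_support_subset_isCompact (Metric.isCompact_of_isClosed_isBounded hKc ?_) hsupp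
    exact isBounded_iff_forall_norm_le.2 ⟨r + exp b, fun x hx ↦ hx.2⟩
  have hsm : ContDiff ℝ (⊤ : ℕ∞) (fun x : EuclideanSpace ℝ (Fin n) ↦ ψ ‖x‖) := by
    refine contDiff_iff_contDiffAt.2 fun x ↦ ?_
    by_cases hx : x ∈ K
    · obtain ⟨h1, -⟩ := hKΩ hx
      have hN : ContDiffAt ℝ (⊤ : ℕ∞) (fun x : EuclideanSpace ℝ (Fin n) ↦ ‖x‖ - r) x :=
        (contDiffAt_norm ℝ (norm_pos_iff.1 (hr.trans h1))).sub contDiffAt_const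
      have h0 := (sub_pos.2 h1).ne'
      exact (hN.sqrt h0).mul (hη.contDiffAt.comp x (hN.log h0))
    · exact contDiffAt_const.congr_of_eventuallyEq
        (notMem_tsupport_iff_eventuallyEq.1 fun h ↦ hx (hts h))
  have hder {y : ℝ} (hy : r < y) :
      HasDerivAt ψ ((√(y - r))⁻¹ * (η (log (y - r)) / 2 + deriv η (log (y - r)))) y := by
    have h0 : 0 < y - r := sub_pos.2 hy
    have hsub := (hasDerivAt_id y).sub_const r
    have hη' := (hη.differentiable (by simp) (log (y - r))).hasDerivAt
    refine ((hsub.sqrt h0.ne').mul (hη'.comp y (hsub.log h0.ne'))).congr_deriv ?_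
    have hq : √(y - r) ≠ 0 := (sqrt_pos.2 h0).ne'
    have hsq : (y - r) = √(y - r) ^ 2 := (sq_sqrt h0.le).symm
    simp only [id, Function.comp_apply]
    generalize η (log (y - r)) = p
    generalize deriv η (log (y - r)) = p'
    generalize √(y - r) = q at *
    rw [hsq]
    field_simp
  have key := H _ hsm hcs (hts.trans hKΩ)
  have hmeas : MeasurableSet {x : EuclideanSpace ℝ (Fin n) | r < ‖x‖ ∧ ‖x‖ < R} :=
    ((isOpen_lt continuous_const continuous_norm).inter
      (isOpen_lt continuous_norm continuous_const)).measurableSet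
  rw [setIntegral_congr_fun (g := fun x ↦ (fun y ↦ ψ y ^ 2 / (y - r) ^ 2) ‖x‖) hmeas,
    setIntegral_congr_fun (f := fun x ↦ ‖gradient _ x‖ ^ 2) (g := fun x ↦ (fun y ↦
      ((√(y - r))⁻¹ * (η (log (y - r)) / 2 + deriv η (log (y - r)))) ^ 2) ‖x‖) hmeas,
    setIntegral_annulus_comp_norm hn hr hrR (fun y ↦ ψ y ^ 2 / (y - r) ^ 2),
    setIntegral_annulus_comp_norm hn hr hrR (fun y ↦
      ((√(y - r))⁻¹ * (η (log (y - r)) / 2 + deriv η (log (y - r)))) ^ 2),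
    mul_left_comm] at key
  rotate_left
  · intro x hx
    have hN : DifferentiableAt ℝ (fun x : EuclideanSpace ℝ (Fin n) ↦ ‖x‖) x :=
      (contDiffAt_norm ℝ (norm_pos_iff.1 (hr.trans hx.1))).differentiableAt one_ne_zero
    have := ((hder hx.1).comp_hasFDerivAt x hN.hasFDerivAt).fderiv
    simp only [Function.comp_def] at this
    simp only [norm_gradient_eq_norm_fderiv, this]
    rw [norm_smul, norm_fderiv_norm hN, mul_one, Real.norm_eq_abs, sq_abs]
  · intro x hx
    by_cases h0 : ψ ‖x‖ = 0
    · simp [h0]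
    · have hxK := hsupp h0
      simp only
      rw [infDist_compl_annulus_eq hr hx.1 (by linarith [hxK.2])]
  have hC : 0 < n * volume.real (Metric.ball (0 : EuclideanSpace ℝ (Fin n)) 1) :=
    mul_pos (by simpa using hn0.pos) (ENNReal.toReal_pos
      (Metric.measure_ball_pos _ _ one_pos).ne' measure_ball_lt_top.ne)
  replace key := le_of_mul_le_mul_left key hC
  have hblog : b < log (R - r) := by
    rw [lt_log_iff_exp_lt (sub_pos.2 hrR)]
    linarith [exp_pos b]
  have e1 (s : ℝ) : exp s * (ψ (r + exp s) ^ 2 / (r + exp s - r) ^ 2) = η s ^ 2 := by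
    simp only [hψ, add_sub_cancel_left, log_exp, mul_pow, sq_sqrt (exp_pos s).le]
    have := (exp_pos s).ne'
    field_simp
  have e2 (s : ℝ) : exp s * ((√(r + exp s - r))⁻¹ *
      (η (log (r + exp s - r)) / 2 + deriv η (log (r + exp s - r)))) ^ 2 =
      (η s / 2 + deriv η s) ^ 2 := by
    simp only [add_sub_cancel_left, log_exp, mul_pow, inv_pow, sq_sqrt (exp_pos s).le]
    have := (exp_pos s).ne'
    field_simp
  simp only [e1, e2] at key
  have hη0 : ∀ s ∉ Set.Iio (log (R - r)), η s = 0 := fun s hs' ↦ by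
    by_contra h
    exact hs' ((hs h).2.trans_lt hblog)
  have hdη0 : ∀ s ∉ Set.Iio (log (R - r)), deriv η s = 0 := fun s hs' ↦ by
    by_contra h
    exact hs' ((closure_minimal hs isClosed_Icc (support_deriv_subset h)).2.trans_lt hblog)
  rwa [setIntegral_eq_integral_of_forall_compl_eq_zero fun s hs' ↦ by simp [hη0 s hs'],
    setIntegral_eq_integral_of_forall_compl_eq_zero fun s hs' ↦ by
      simp [hη0 s hs', hdη0 s hs']] at key

theorem integral_half_add_deriv_sq {η : ℝ → ℝ} (hη : ContDiff ℝ 1 η)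
    (hc : HasCompactSupport η) :
    ∫ s, (η s / 2 + deriv η s) ^ 2 = 1 / 4 * (∫ s, η s ^ 2) + ∫ s, deriv η s ^ 2 := by
  have hd : Continuous (deriv η) := hη.continuous_deriv le_rfl
  have hη0 : Continuous η := hη.continuous
  have i1 : Integrable fun s ↦ η s ^ 2 :=
    Continuous.integrable_of_hasCompactSupport (by fun_prop)
      (hc.mono fun s hs hs' ↦ hs (by simp [hs']))
  have i2 : Integrable fun s ↦ deriv η s ^ 2 :=
    Continuous.integrable_of_hasCompactSupport (by fun_prop)
      (hc.deriv.mono fun s hs hs' ↦ hs (by simp [hs']))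
  have i3 : Integrable fun s ↦ η s * deriv η s :=
    Continuous.integrable_of_hasCompactSupport (by fun_prop) hc.mul_right
  have h0 : ∫ s, η s * deriv η s = 0 := by
    refine integral_eq_zero_of_hasDerivAt_of_integrable (f := fun s ↦ 1 / 2 * η s ^ 2)
      (fun s ↦ ?_) i3 (i1.const_mul _)
    refine (((hη.differentiable one_ne_zero s).hasDerivAt.pow 2).const_mul (1 / 2)).congr_deriv ?_
    simp only [Nat.cast_ofNat, Nat.add_one_sub_one, pow_one]
    ring
  have : ∀ s, (η s / 2 + deriv η s) ^ 2 = 1 / 4 * η s ^ 2 + η s * deriv η s + deriv η s ^ 2 :=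
    fun s ↦ by ring
  simp_rw [this]
  have i4 : Integrable fun s ↦ 1 / 4 * η s ^ 2 + η s * deriv η s := (i1.const_mul _).add i3
  rw [integral_add i4 i2, integral_add (i1.const_mul _) i3, h0, integral_const_mul, add_zero]

theorem HasHardyConstant.log_inequality_of_support_subset {n : ℕ} (hn : 3 ≤ n) {r R : ℝ}
    (hr : 0 < r) (hrR : r < R) {c : ℝ} (hc0 : 0 ≤ c)
    (H : HasHardyConstant {x : EuclideanSpace ℝ (Fin n) | r < ‖x‖ ∧ ‖x‖ < R} c)
    {η : ℝ → ℝ} (hη : ContDiff ℝ (⊤ : ℕ∞) η) {a b : ℝ} (hs : Function.support η ⊆ Set.Icc a b)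
    (hb : 2 * exp b ≤ R - r) :
    c * (r ^ (n - 1) * ∫ s, η s ^ 2) ≤
      (r + exp b) ^ (n - 1) * (1 / 4 * (∫ s, η s ^ 2) + ∫ s, deriv η s ^ 2) := by
  have hc : HasCompactSupport η := .of_support_subset_isCompact isCompact_Icc hs
  have hη1 : ContDiff ℝ 1 η := hη.of_le (by exact_mod_cast le_top)
  have hd : Continuous (deriv η) := hη1.continuous_deriv le_rfl
  have hη0 : Continuous η := hη.continuous
  have hsupp (s : ℝ) (hs' : (η s / 2 + deriv η s) ^ 2 ≠ 0) : s ∈ Set.Icc a b := by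
    by_contra h
    have h1 : η s = 0 := by
      by_contra h'
      exact h (hs h')
    have h2 : deriv η s = 0 := by
      by_contra h'
      exact h (closure_minimal hs isClosed_Icc (support_deriv_subset h'))
    exact hs' (by simp [h1, h2])
  have hcd : HasCompactSupport fun s ↦ (η s / 2 + deriv η s) ^ 2 :=
    .of_support_subset_isCompact isCompact_Icc hsupp
  have hc2 : HasCompactSupport fun s ↦ η s ^ 2 := hc.mono fun s hs hs' ↦ hs (by simp [hs'])
  calc c * (r ^ (n - 1) * ∫ s, η s ^ 2)
      ≤ c * ∫ s, (r + exp s) ^ (n - 1) * η s ^ 2 := by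
        rw [← integral_const_mul]
        refine mul_le_mul_of_nonneg_left (integral_mono ?_ ?_ fun s ↦ ?_) hc0
        · exact Continuous.integrable_of_hasCompactSupport (by fun_prop) hc2.mul_left
        · exact Continuous.integrable_of_hasCompactSupport (by fun_prop) hc2.mul_left
        · have := exp_pos s
          simp only
          gcongr
          linarith
    _ ≤ ∫ s, (r + exp s) ^ (n - 1) * (η s / 2 + deriv η s) ^ 2 :=
        H.weighted_log_inequality hn hr hrR hη hs hb
    _ ≤ ∫ s, (r + exp b) ^ (n - 1) * (η s / 2 + deriv η s) ^ 2 := by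
        refine integral_mono ?_ ?_ fun s ↦ ?_
        · exact Continuous.integrable_of_hasCompactSupport (by fun_prop) hcd.mul_left
        · exact Continuous.integrable_of_hasCompactSupport (by fun_prop) hcd.mul_left
        · by_cases h : (η s / 2 + deriv η s) ^ 2 = 0
          · simp [h]
          · have := (hsupp s h).2
            simp only
            gcongr
    _ = _ := by rw [integral_const_mul, integral_half_add_deriv_sq hη1 hc]

theorem HasHardyConstant.log_inequality {n : ℕ} (hn : 3 ≤ n) {r R : ℝ}
    (hr : 0 < r) (hrR : r < R) {c : ℝ} (hc0 : 0 ≤ c)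
    (H : HasHardyConstant {x : EuclideanSpace ℝ (Fin n) | r < ‖x‖ ∧ ‖x‖ < R} c)
    {η : ℝ → ℝ} (hη : ContDiff ℝ (⊤ : ℕ∞) η) (hc : HasCompactSupport η) :
    c * ∫ s, η s ^ 2 ≤ 1 / 4 * (∫ s, η s ^ 2) + ∫ s, deriv η s ^ 2 := by
  obtain ⟨M, hM⟩ := isBounded_iff_forall_norm_le.1 hc.isCompact.isBounded
  have hexp : Filter.Tendsto (fun T : ℝ ↦ exp (M - T)) Filter.atTop (nhds 0) :=
    tendsto_exp_atBot.comp (Filter.tendsto_atBot_add_const_left _ M Filter.tendsto_neg_atTop_atBot)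
  have hlim : Filter.Tendsto (fun T : ℝ ↦ (r + exp (M - T)) ^ (n - 1) *
      (1 / 4 * (∫ s, η s ^ 2) + ∫ s, deriv η s ^ 2)) Filter.atTop
      (nhds (r ^ (n - 1) * (1 / 4 * (∫ s, η s ^ 2) + ∫ s, deriv η s ^ 2))) := by
    have := ((hexp.const_add r).pow (n - 1)).mul_const
      (1 / 4 * (∫ s, η s ^ 2) + ∫ s, deriv η s ^ 2)
    rwa [add_zero] at this
  have hfin : c * (r ^ (n - 1) * ∫ s, η s ^ 2) ≤
      r ^ (n - 1) * (1 / 4 * (∫ s, η s ^ 2) + ∫ s, deriv η s ^ 2) := by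
    refine ge_of_tendsto hlim ?_
    filter_upwards [hexp.eventually (ge_mem_nhds (half_pos (sub_pos.2 hrR)))] with T hT
    have hs : Function.support (fun s ↦ η (s + T)) ⊆ Set.Icc (-M - T) (M - T) := fun s hs ↦ by
      have := abs_le.1 (hM _ (subset_tsupport _ hs))
      exact ⟨by linarith, by linarith⟩
    have h := H.log_inequality_of_support_subset hn hr hrR hc0
      (η := fun s ↦ η (s + T)) (by fun_prop) hs (by linarith)
    simp only [deriv_comp_add_const] at h
    rwa [integral_add_right_eq_self (fun s ↦ η s ^ 2),
      integral_add_right_eq_self (fun s ↦ deriv η s ^ 2)] at h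
  rw [mul_left_comm] at hfin
  exact le_of_mul_le_mul_left hfin (by positivity)

theorem HasHardyConstant.le_one_fourth {n : ℕ} (hn : 3 ≤ n) {r R : ℝ}
    (hr : 0 < r) (hrR : r < R) {c : ℝ}
    (H : HasHardyConstant {x : EuclideanSpace ℝ (Fin n) | r < ‖x‖ ∧ ‖x‖ < R} c) :
    c ≤ 1 / 4 := by
  rcases le_total c 0 with hc0 | hc0
  · linarith
  let f : ContDiffBump (0 : ℝ) := ⟨1, 2, one_pos, one_lt_two⟩
  have hf : ContDiff ℝ (⊤ : ℕ∞) f := f.contDiff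
  have hpos : 0 < ∫ s, f s ^ 2 := by
    refine Continuous.integral_pos_of_hasCompactSupport_nonneg_nonzero (x := 0) (by fun_prop)
      (f.hasCompactSupport.mono fun s hs hs' ↦ hs (by simp [hs'])) (fun s ↦ sq_nonneg _) ?_
    have : f 0 = 1 := f.one_of_mem_closedBall (by simp [f.rIn_pos.le])
    simp [this]
  have hlim : Filter.Tendsto (fun l : ℝ ↦ 1 / 4 * (∫ s, f s ^ 2) + l⁻¹ ^ 2 * ∫ s, deriv f s ^ 2)
      Filter.atTop (nhds (1 / 4 * ∫ s, f s ^ 2)) := by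
    have := ((tendsto_inv_atTop_zero (𝕜 := ℝ).pow 2).mul_const
      (∫ s, deriv f s ^ 2)).const_add (1 / 4 * ∫ s, f s ^ 2)
    simpa using this
  refine le_of_mul_le_mul_right (ge_of_tendsto hlim ?_) hpos
  filter_upwards [Filter.eventually_gt_atTop 0] with l hl
  have hcs : HasCompactSupport fun s ↦ f (l⁻¹ * s) :=
    f.hasCompactSupport.comp_homeomorph (Homeomorph.mulLeft₀ l⁻¹ (inv_ne_zero hl.ne'))
  have h := H.log_inequality hn hr hrR hc0 (η := fun s ↦ f (l⁻¹ * s)) (by fun_prop) hcs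
  simp only [deriv_comp_mul_left, smul_eq_mul, mul_pow] at h
  rw [integral_const_mul, Measure.integral_comp_mul_left (fun s ↦ f s ^ 2),
    Measure.integral_comp_mul_left (fun s ↦ deriv f s ^ 2), inv_inv, abs_of_pos hl,
    smul_eq_mul, smul_eq_mul] at h
  refine le_of_mul_le_mul_left ?_ hl
  linarith

/-- **The Hardy constant of an annulus is 1/4.**
For `n ≥ 3` and `0 < r < R < ∞`, the annulus `Ω = {x ∈ ℝⁿ : r < |x| < R}` satisfies
`∫_Ω ‖∇u‖² ≥ (1/4) ∫_Ω u²/d²` for all `u ∈ C_c^∞(Ω)`, and `1/4` is the largest constant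
for which this holds. -/
theorem hardy_constant_annulus
    (n : ℕ) (hn : 3 ≤ n) (r R : ℝ) (hr : 0 < r) (hrR : r < R)
    (Ω : Set (EuclideanSpace ℝ (Fin n)))
    (hΩ : Ω = {x : EuclideanSpace ℝ (Fin n) | r < ‖x‖ ∧ ‖x‖ < R}) :
    (∀ u : EuclideanSpace ℝ (Fin n) → ℝ,
        ContDiff ℝ (⊤ : ℕ∞) u → HasCompactSupport u → tsupport u ⊆ Ω →
        (1 / 4 : ℝ) * ∫ x in Ω, u x ^ 2 / Metric.infDist x Ωᶜ ^ 2
          ≤ ∫ x in Ω, ‖gradient u x‖ ^ 2) ∧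
    (∀ c : ℝ,
      (∀ u : EuclideanSpace ℝ (Fin n) → ℝ,
        ContDiff ℝ (⊤ : ℕ∞) u → HasCompactSupport u → tsupport u ⊆ Ω →
        c * ∫ x in Ω, u x ^ 2 / Metric.infDist x Ωᶜ ^ 2
          ≤ ∫ x in Ω, ‖gradient u x‖ ^ 2) → c ≤ 1 / 4) := by
  subst hΩ
  exact ⟨fun u hu hc hs ↦ hardy_inequality_annulus hn hr hu hc hs,
    fun c H ↦ HasHardyConstant.le_one_fourth hn hr hrR H⟩
end
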